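/- arXiv:2304.02611 — 13 statements merged into one kernel-verified Lean document; each statement's English description precedes it below -/
import Mathlib

section
/- Let (X_i)_{i≥1} be an exchangeable sequence of integrable real-valued random variables (the joint law of (X_1,…,X_n) equals that of (X_{π(1)},…,X_{π(n)}) for every n ≥ 1 and every permutation π of {1,…,n}). Then for every a > 0, P(∃ t ≥ 1 : |(1/t) ∑_{i=1}^t X_i| ≥ 1/a) ≤ P(∃ t ≥ 1 : (1/t) ∑_{i=1}^t |X_i| ≥ 1/a) ≤ a · E[|X_1|]. -/
open MeasureTheory ProbabilityTheory
open scoped ENNReal BigOperators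

/-- Partial sums of absolute values. -/
def emiS (t : ℕ) (x : ℕ → ℝ) : ℝ := ∑ i ∈ Finset.range t, |x i|

/-- `t` is the last time up to `n` at which the average of absolute values is at least `c`. -/
def emiA (c : ℝ) (n t : ℕ) : Set (ℕ → ℝ) :=
  {x | c * t ≤ emiS t x ∧ ∀ s, t < s → s ≤ n → emiS s x < c * s}

lemma emiS_measurable (t : ℕ) : Measurable (emiS t) := by
  unfold emiS
  fun_prop

lemma emiA_measurable (c : ℝ) (n t : ℕ) : MeasurableSet (emiA c n t) := by
  have : emiA c n t = {x | c * t ≤ emiS t x} ∩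
      ⋂ s : ℕ, ⋂ _ : t < s, ⋂ _ : s ≤ n, {x | emiS s x < c * s} := by
    ext x
    simp [emiA]
  rw [this]
  refine MeasurableSet.inter (measurableSet_le measurable_const (emiS_measurable t)) ?_
  exact MeasurableSet.iInter fun s => MeasurableSet.iInter fun _ => MeasurableSet.iInter fun _ =>
    measurableSet_lt (emiS_measurable s) measurable_const

lemma emiS_swap (t k s : ℕ) (hk : k < t) (hs : t ≤ s) (x : ℕ → ℝ) :
    emiS s (fun i => x (Equiv.swap 0 k i)) = emiS s x := by
  unfold emiS
  refine Equiv.Perm.sum_comp (Equiv.swap 0 k) (Finset.range s) (fun i => |x i|) ?_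
  intro i hi
  simp only [Set.mem_ofPred_eq] at hi
  simp only [Finset.coe_range, Set.mem_Iio]
  by_contra h
  exact hi (Equiv.swap_apply_of_ne_of_ne (by omega) (by omega))

lemma emiA_swap (c : ℝ) (n t k : ℕ) (hk : k < t) (x : ℕ → ℝ) :
    (fun i => x (Equiv.swap 0 k i)) ∈ emiA c n t ↔ x ∈ emiA c n t := by
  unfold emiA
  simp only [Set.mem_ofPred_eq]
  rw [emiS_swap t k t hk le_rfl]
  refine and_congr Iff.rfl (forall_congr' fun s => forall_congr' fun hs => ?_)
  rw [emiS_swap t k s hk hs.le]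

lemma emi_step (μ : Measure (ℕ → ℝ)) (n : ℕ)
    (h : ∀ k < n, μ.map (fun x i => x (Equiv.swap 0 k i)) = μ) (c : ℝ)
    (t : ℕ) (ht : 1 ≤ t) (htn : t ≤ n) :
    ENNReal.ofReal c * μ (emiA c n t) ≤ ∫⁻ x in emiA c n t, ENNReal.ofReal |x 0| ∂μ := by
  have hA := emiA_measurable c n t
  have h1 : ∀ k ∈ Finset.range t, ∫⁻ x in emiA c n t, ENNReal.ofReal |x k| ∂μ
      = ∫⁻ x in emiA c n t, ENNReal.ofReal |x 0| ∂μ := by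
    intro k hk
    rw [Finset.mem_range] at hk
    conv_rhs => rw [← h k (by omega)]
    rw [setLIntegral_map hA (by fun_prop) (by fun_prop)]
    have : (fun (x : ℕ → ℝ) i => x (Equiv.swap 0 k i)) ⁻¹' emiA c n t = emiA c n t := by
      ext x
      exact emiA_swap c n t k hk x
    rw [this]
    simp
  have h2 : ∫⁻ x in emiA c n t, ENNReal.ofReal (emiS t x) ∂μ
      = t * ∫⁻ x in emiA c n t, ENNReal.ofReal |x 0| ∂μ := by
    unfold emiS
    simp_rw [ENNReal.ofReal_sum_of_nonneg (fun i _ => abs_nonneg _)]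
    rw [lintegral_finsetSum _ (fun i _ => by fun_prop), Finset.sum_congr rfl h1]
    simp
  have h3 : ENNReal.ofReal (c * t) * μ (emiA c n t)
      ≤ ∫⁻ x in emiA c n t, ENNReal.ofReal (emiS t x) ∂μ := by
    rw [← setLIntegral_const]
    exact setLIntegral_mono' hA fun x hx => ENNReal.ofReal_le_ofReal hx.1
  rw [h2, mul_comm c, ENNReal.ofReal_mul (by positivity), ENNReal.ofReal_natCast, mul_assoc] at h3
  exact (ENNReal.mul_le_mul_iff_right (by positivity) (by simp)).1 h3

lemma emi_finite (μ : Measure (ℕ → ℝ)) (n : ℕ)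
    (h : ∀ k < n, μ.map (fun x i => x (Equiv.swap 0 k i)) = μ) (c : ℝ) :
    ENNReal.ofReal c * μ {x | ∃ t, 1 ≤ t ∧ t ≤ n ∧ c * t ≤ emiS t x}
      ≤ ∫⁻ x, ENNReal.ofReal |x 0| ∂μ := by
  have hsub : {x | ∃ t, 1 ≤ t ∧ t ≤ n ∧ c * t ≤ emiS t x}
      ⊆ ⋃ t ∈ Finset.Icc 1 n, emiA c n t := by
    rintro x ⟨t, ht, htn, hx⟩
    classical
    let T := (Finset.Icc 1 n).filter (fun t : ℕ => c * t ≤ emiS t x)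
    have hT : T.Nonempty := ⟨t, by simp [T, ht, htn, hx]⟩
    have hm := T.max'_mem hT
    have hm2 := Finset.mem_filter.1 hm
    simp only [Set.mem_iUnion]
    refine ⟨T.max' hT, hm2.1, hm2.2, fun s hs hsn => ?_⟩
    by_contra hc
    have : s ∈ T := by
      simp only [T, Finset.mem_filter, Finset.mem_Icc]
      exact ⟨⟨by omega, hsn⟩, not_lt.1 hc⟩
    have := T.le_max' s this
    omega
  have hdis : Set.PairwiseDisjoint (↑(Finset.Icc 1 n)) (emiA c n) := by
    have key : ∀ s t, t ≤ n → s < t → Disjoint (emiA c n s) (emiA c n t) := by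
      intro s t htn hst
      rw [Set.disjoint_left]
      intro x hs ht
      exact absurd ht.1 (not_le.2 (hs.2 t hst htn))
    intro s hs t ht hst
    simp only [Finset.coe_Icc, Set.mem_Icc] at hs ht
    rcases lt_or_gt_of_ne hst with hlt | hlt
    · exact key s t ht.2 hlt
    · exact (key t s hs.2 hlt).symm
  calc _ ≤ ENNReal.ofReal c * ∑ t ∈ Finset.Icc 1 n, μ (emiA c n t) := by
        gcongr
        exact (measure_mono hsub).trans (measure_biUnion_finset_le _ _)
    _ = ∑ t ∈ Finset.Icc 1 n, ENNReal.ofReal c * μ (emiA c n t) := Finset.mul_sum _ _ _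
    _ ≤ ∑ t ∈ Finset.Icc 1 n, ∫⁻ x in emiA c n t, ENNReal.ofReal |x 0| ∂μ := by
        refine Finset.sum_le_sum fun t ht => ?_
        rw [Finset.mem_Icc] at ht
        exact emi_step μ n h c t ht.1 ht.2
    _ = ∫⁻ x in ⋃ t ∈ Finset.Icc 1 n, emiA c n t, ENNReal.ofReal |x 0| ∂μ :=
        (lintegral_biUnion_finset hdis (fun t _ => emiA_measurable c n t) _).symm
    _ ≤ _ := setLIntegral_le_lintegral _ _

/-- Extension of a finite vector by zero. -/
def emiExt (n : ℕ) (x : Fin n → ℝ) (i : ℕ) : ℝ := if h : i < n then x ⟨i, h⟩ else 0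

lemma emiExt_measurable (n : ℕ) : Measurable (emiExt n) := by
  refine measurable_pi_lambda _ fun i => ?_
  unfold emiExt
  split_ifs <;> fun_prop

lemma emi_bound
    {Ω : Type*} [MeasurableSpace Ω] (P : Measure Ω)
    (X : ℕ → Ω → ℝ)
    (hmeas : ∀ i, Measurable (X i))
    (hexch : ∀ (n : ℕ) (π : Equiv.Perm (Fin n)),
      Measure.map (fun ω => fun i : Fin n => X (π i) ω) P
        = Measure.map (fun ω => fun i : Fin n => X i ω) P)
    (c : ℝ) (n : ℕ) :
    ENNReal.ofReal c * P {ω | ∃ t : ℕ, 1 ≤ t ∧ t ≤ n ∧ c * t ≤ ∑ i ∈ Finset.range t, |X i ω|}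
      ≤ ∫⁻ ω, ENNReal.ofReal |X 0 ω| ∂P := by
  rcases Nat.eq_zero_or_pos n with rfl | hn
  · have : {ω | ∃ t : ℕ, 1 ≤ t ∧ t ≤ 0 ∧ c * t ≤ ∑ i ∈ Finset.range t, |X i ω|} = ∅ := by
      ext ω
      simp only [Set.mem_ofPred_eq, Set.mem_empty_iff_false, iff_false]
      rintro ⟨t, h1, h2, _⟩
      omega
    rw [this]
    simp
  have hE := emiExt_measurable n
  have hXn : Measurable (fun ω => fun i : Fin n => X i ω) :=
    measurable_pi_lambda _ fun i => hmeas i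
  set μ := Measure.map (emiExt n) (Measure.map (fun ω => fun i : Fin n => X i ω) P) with hμ
  have hsw : ∀ k < n, μ.map (fun x i => x (Equiv.swap 0 k i)) = μ := by
    intro k hk
    have e := hexch n (Equiv.swap ⟨0, hn⟩ ⟨k, hk⟩)
    conv_rhs => rw [hμ, ← e]
    rw [hμ, Measure.map_map hE hXn, Measure.map_map (by fun_prop) (hE.comp hXn),
      Measure.map_map hE (measurable_pi_lambda _ fun i => hmeas _)]
    congr 1
    funext ω i
    simp only [Function.comp, emiExt]
    by_cases hi : i < n
    · have hs : ((Equiv.swap (⟨0, hn⟩ : Fin n) ⟨k, hk⟩ ⟨i, hi⟩ : Fin n) : ℕ)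
          = Equiv.swap 0 k i := by
        simp only [Equiv.swap_apply_def, Fin.mk.injEq]
        split_ifs <;> rfl
      have hlt : Equiv.swap 0 k i < n := hs ▸ Fin.isLt _
      simp [hi, hlt, hs]
    · have : Equiv.swap 0 k i = i := Equiv.swap_apply_of_ne_of_ne (by omega) (by omega)
      simp [this, hi]
  have hfin := emi_finite μ n hsw c
  have hms : MeasurableSet {x : ℕ → ℝ | ∃ t : ℕ, 1 ≤ t ∧ t ≤ n ∧ c * t ≤ emiS t x} := by
    simp only [Set.ofPred_exists]
    refine MeasurableSet.iUnion fun t => ?_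
    exact (MeasurableSet.const _).inter ((MeasurableSet.const _).inter
      (measurableSet_le measurable_const (emiS_measurable t)))
  rw [hμ, Measure.map_map hE hXn, Measure.map_apply (hE.comp hXn) hms,
    lintegral_map (by fun_prop) (hE.comp hXn)] at hfin
  convert hfin using 3
  · ext ω
    simp only [Set.mem_ofPred_eq, Set.mem_preimage]
    refine exists_congr fun t => and_congr_right fun _ => and_congr_right fun ht => ?_
    have : ∑ i ∈ Finset.range t, |X i ω| = emiS t ((emiExt n ∘ fun ω (i : Fin n) => X i ω) ω) := by
      refine Finset.sum_congr rfl fun i hi => ?_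
      have : i < n := by rw [Finset.mem_range] at hi; omega
      simp [emiExt, this]
    rw [this]
  · simp [emiExt, hn]

/-- **Exchangeable Markov inequality (EMI).** For an exchangeable sequence
`X 0, X 1, …` of integrable random variables (indexed from 0, so `X 0` plays the
role of `X₁`), for every `a > 0`,
`P(∃ t ≥ 1, |(1/t) ∑_{i<t} X i| ≥ 1/a) ≤ P(∃ t ≥ 1, (1/t) ∑_{i<t} |X i| ≥ 1/a)
  ≤ a · E[|X 0|]`. -/
theorem exchangeable_markov_inequality
    {Ω : Type*} [MeasurableSpace Ω] (P : Measure Ω) [IsProbabilityMeasure P]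
    (X : ℕ → Ω → ℝ)
    (hmeas : ∀ i, Measurable (X i))
    (hint : ∀ i, Integrable (X i) P)
    (hexch : ∀ (n : ℕ) (π : Equiv.Perm (Fin n)),
      Measure.map (fun ω => fun i : Fin n => X (π i) ω) P
        = Measure.map (fun ω => fun i : Fin n => X i ω) P)
    (a : ℝ) (ha : 0 < a) :
    P {ω | ∃ t : ℕ, 1 ≤ t ∧ |(t : ℝ)⁻¹ * ∑ i ∈ Finset.range t, X i ω| ≥ 1 / a}
        ≤ P {ω | ∃ t : ℕ, 1 ≤ t ∧ (t : ℝ)⁻¹ * ∑ i ∈ Finset.range t, |X i ω| ≥ 1 / a}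
      ∧ P {ω | ∃ t : ℕ, 1 ≤ t ∧ (t : ℝ)⁻¹ * ∑ i ∈ Finset.range t, |X i ω| ≥ 1 / a}
        ≤ ENNReal.ofReal (a * ∫ ω, |X 0 ω| ∂P) := by
  have hca : 0 < 1 / a := by positivity
  constructor
  · refine measure_mono ?_
    rintro ω ⟨t, ht, h⟩
    refine ⟨t, ht, h.le.trans ?_⟩
    rw [abs_mul, abs_of_nonneg (by positivity : (0:ℝ) ≤ (t:ℝ)⁻¹)]
    exact mul_le_mul_of_nonneg_left (Finset.abs_sum_le_sum_abs _ _) (by positivity)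
  · have hU : {ω | ∃ t : ℕ, 1 ≤ t ∧ (t : ℝ)⁻¹ * ∑ i ∈ Finset.range t, |X i ω| ≥ 1 / a}
        = ⋃ n : ℕ, {ω | ∃ t : ℕ, 1 ≤ t ∧ t ≤ n ∧
            (1 / a) * t ≤ ∑ i ∈ Finset.range t, |X i ω|} := by
      ext ω
      have key : ∀ t : ℕ, 1 ≤ t → ((t : ℝ)⁻¹ * ∑ i ∈ Finset.range t, |X i ω| ≥ 1 / a ↔
          (1 / a) * t ≤ ∑ i ∈ Finset.range t, |X i ω|) := by
        intro t ht
        have : (0 : ℝ) < t := by exact_mod_cast ht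
        rw [ge_iff_le, le_inv_mul_iff₀ this, mul_comm]
      simp only [Set.mem_ofPred_eq, Set.mem_iUnion]
      constructor
      · rintro ⟨t, ht, h⟩
        exact ⟨t, t, ht, le_rfl, (key t ht).1 h⟩
      · rintro ⟨n, t, ht, _, h⟩
        exact ⟨t, ht, (key t ht).2 h⟩
    have hmono : Monotone fun n : ℕ => {ω | ∃ t : ℕ, 1 ≤ t ∧ t ≤ n ∧
            (1 / a) * t ≤ ∑ i ∈ Finset.range t, |X i ω|} := by
      rintro m n hmn ω ⟨t, h1, h2, h3⟩
      exact ⟨t, h1, h2.trans hmn, h3⟩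
    rw [hU, hmono.measure_iUnion]
    refine iSup_le fun n => ?_
    have hb := emi_bound P X hmeas hexch (1 / a) n
    rw [ENNReal.ofReal_mul ha.le, ofReal_integral_eq_lintegral_ofReal (hint 0).abs
      (Filter.Eventually.of_forall fun _ => abs_nonneg _)]
    have h1 : ENNReal.ofReal a * ENNReal.ofReal (1 / a) = 1 := by
      rw [← ENNReal.ofReal_mul ha.le, mul_one_div_cancel ha.ne', ENNReal.ofReal_one]
    refine le_trans (le_of_eq ?_) (mul_le_mul_right hb (ENNReal.ofReal a))
    rw [← mul_assoc, h1, one_mul]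
end

section
/- Let X_1,…,X_n be integrable real-valued random variables with arbitrary dependence, and let π be a uniformly random permutation of {1,…,n}, independent of (X_1,…,X_n). Then for every a > 0, P( sup_{1 ≤ t ≤ n} (1/t) ∑_{i=1}^t |X_{π(i)}| ≥ 1/a ) ≤ a · E[|X_1| + |X_2| + ⋯ + |X_n|]/n. -/
open MeasureTheory ProbabilityTheory
open scoped ENNReal BigOperators

/-- Permutations of `Fin n` carry the discrete σ-algebra. -/
instance (n : ℕ) : MeasurableSpace (Equiv.Perm (Fin n)) := ⊤

instance (n : ℕ) : Nonempty (Equiv.Perm (Fin n)) := ⟨1⟩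

/-- Partial sums along a permutation. -/
def pmS {n : ℕ} (x : Fin n → ℝ) (s : Equiv.Perm (Fin n)) (t : ℕ) : ℝ :=
  ∑ i ∈ Finset.univ.filter (fun i : Fin n => (i : ℕ) < t), x (s i)

lemma pmS_swap {n : ℕ} (x : Fin n → ℝ) (s : Equiv.Perm (Fin n)) (t : ℕ) (i j : Fin n)
    (hi : (i : ℕ) < t) (hj : (j : ℕ) < t) : pmS x (s * Equiv.swap i j) t = pmS x s t := by
  unfold pmS
  refine Finset.sum_equiv (Equiv.swap i j) ?_ ?_
  · intro k
    simp only [Finset.mem_filter, Finset.mem_univ, true_and]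
    rcases eq_or_ne k i with rfl | hki
    · simp [hi, hj]
    rcases eq_or_ne k j with rfl | hkj
    · simp [hi, hj]
    rw [Equiv.swap_apply_of_ne_of_ne hki hkj]
  · intro k _
    rfl

lemma pm_sum_swap {n : ℕ} (x : Fin n → ℝ) (E : Finset (Equiv.Perm (Fin n))) (i j : Fin n)
    (hE : ∀ s, s * Equiv.swap i j ∈ E ↔ s ∈ E) :
    ∑ s ∈ E, x (s i) = ∑ s ∈ E, x (s j) := by
  refine Finset.sum_equiv (Equiv.mulRight (Equiv.swap i j)) ?_ ?_
  · intro s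
    simpa using (hE s).symm
  · intro s _
    simp

lemma pm_total {n : ℕ} (x : Fin n → ℝ) (j : Fin n) :
    (n : ℝ) * ∑ s : Equiv.Perm (Fin n), x (s j) = (n.factorial : ℝ) * ∑ i, x i := by
  have h1 : ∀ i, ∑ s : Equiv.Perm (Fin n), x (s i) = ∑ s : Equiv.Perm (Fin n), x (s j) :=
    fun i => pm_sum_swap x Finset.univ i j (by simp)
  have h2 : ∑ i, ∑ s : Equiv.Perm (Fin n), x (s i) = (n.factorial : ℝ) * ∑ i, x i := by
    rw [Finset.sum_comm]
    simp_rw [fun s : Equiv.Perm (Fin n) => Equiv.sum_comp s x]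
    simp [Fintype.card_perm]
  rw [← h2]
  simp_rw [h1]
  simp

open Classical in
/-- Permutations whose last crossing time is `t`. -/
noncomputable def pmE {n : ℕ} (x : Fin n → ℝ) (c : ℝ) (t : ℕ) : Finset (Equiv.Perm (Fin n)) :=
  Finset.univ.filter (fun s => c * t ≤ pmS x s t ∧ ∀ u, t < u → u ≤ n → pmS x s u < c * u)

lemma pmE_bound {n : ℕ} (x : Fin n → ℝ) (c : ℝ) (t : ℕ) (h1 : 1 ≤ t) (h2 : t ≤ n) (j : Fin n)
    (hj : (j : ℕ) = 0) :
    c * (pmE x c t).card ≤ ∑ s ∈ pmE x c t, x (s j) := by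
  have hsw : ∀ i : Fin n, (i : ℕ) < t →
      ∑ s ∈ pmE x c t, x (s i) = ∑ s ∈ pmE x c t, x (s j) := by
    intro i hi
    apply pm_sum_swap
    intro s
    simp only [pmE, Finset.mem_filter, Finset.mem_univ, true_and]
    rw [pmS_swap x s t i j hi (by omega)]
    refine and_congr_right fun _ => forall_congr' fun u => forall_congr' fun hu => ?_
    rw [pmS_swap x s u i j (by omega) (by omega)]
  have h3 : ∑ s ∈ pmE x c t, pmS x s t = t * ∑ s ∈ pmE x c t, x (s j) := by
    unfold pmS
    rw [Finset.sum_comm, Finset.sum_congr rfl (fun i hi => hsw i (by simpa using hi))]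
    rw [Finset.sum_const, nsmul_eq_mul]
    congr 2
    rw [Fin.card_filter_val_lt]
    simp [h2]
  have h4 : ∑ s ∈ pmE x c t, c * (t : ℝ) ≤ ∑ s ∈ pmE x c t, pmS x s t :=
    Finset.sum_le_sum fun s hs => by
      simp only [pmE, Finset.mem_filter] at hs
      exact hs.2.1
  rw [h3, Finset.sum_const, nsmul_eq_mul] at h4
  have ht : (0 : ℝ) < t := by exact_mod_cast h1
  refine le_of_mul_le_mul_left ?_ ht
  linarith

open Classical in
lemma pm_comb {n : ℕ} (hn : 0 < n) (x : Fin n → ℝ) (hx : ∀ i, 0 ≤ x i) (c : ℝ) :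
    (n : ℝ) * (c * ((Finset.univ.filter (fun s : Equiv.Perm (Fin n) =>
      ∃ t : ℕ, 1 ≤ t ∧ t ≤ n ∧ c * t ≤ pmS x s t)).card : ℝ))
      ≤ (n.factorial : ℝ) * ∑ i, x i := by
  set j : Fin n := ⟨0, hn⟩
  rw [← pm_total x j]
  refine mul_le_mul_of_nonneg_left ?_ (Nat.cast_nonneg n)
  have hdisj : Set.PairwiseDisjoint (↑(Finset.Icc 1 n) : Set ℕ) (pmE x c) := by
    have key : ∀ t u : ℕ, t < u → u ≤ n → Disjoint (pmE x c t) (pmE x c u) := by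
      intro t u htu hu
      rw [Finset.disjoint_left]
      intro s hs hs'
      simp only [pmE, Finset.mem_filter] at hs hs'
      exact absurd (hs.2.2 u htu hu) (not_lt.2 hs'.2.1)
    intro t ht u hu htu
    simp only [Finset.coe_Icc, Set.mem_Icc] at ht hu
    rcases lt_or_gt_of_ne htu with h | h
    · exact key t u h hu.2
    · exact (key u t h ht.2).symm
  have hset : (Finset.univ.filter (fun s : Equiv.Perm (Fin n) =>
      ∃ t : ℕ, 1 ≤ t ∧ t ≤ n ∧ c * t ≤ pmS x s t)) = (Finset.Icc 1 n).biUnion (pmE x c) := by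
    ext s
    simp only [Finset.mem_filter, Finset.mem_univ, true_and, Finset.mem_biUnion, Finset.mem_Icc,
      pmE]
    constructor
    · rintro ⟨t, h1, h2, h3⟩
      have hne : ((Finset.Icc 1 n).filter (fun t : ℕ => c * t ≤ pmS x s t)).Nonempty :=
        ⟨t, by simp [h1, h2, h3]⟩
      obtain ⟨m, hm, hmax⟩ := Finset.exists_max_image _ (fun t : ℕ => t) hne
      simp only [Finset.mem_filter, Finset.mem_Icc] at hm hmax
      refine ⟨m, hm.1, hm.2, fun u hu hun => ?_⟩
      by_contra hcon
      have := hmax u ⟨⟨by omega, hun⟩, not_lt.1 hcon⟩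
      omega
    · rintro ⟨t, ⟨h1, h2⟩, h3, _⟩
      exact ⟨t, h1, h2, h3⟩
  rw [hset, Finset.card_biUnion hdisj]
  push_cast
  rw [Finset.mul_sum]
  calc _ ≤ ∑ t ∈ Finset.Icc 1 n, ∑ s ∈ pmE x c t, x (s j) :=
        Finset.sum_le_sum fun t ht => by
          rw [Finset.mem_Icc] at ht
          exact pmE_bound x c t ht.1 ht.2 j rfl
    _ = ∑ s ∈ (Finset.Icc 1 n).biUnion (pmE x c), x (s j) := (Finset.sum_biUnion hdisj).symm
    _ ≤ _ := Finset.sum_le_sum_of_subset_of_nonneg (Finset.subset_univ _) fun s _ _ => hx _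

/-- **Permuted corollary of the exchangeable Markov inequality.** If
`X 0, …, X (n-1)` are arbitrarily dependent integrable random variables and
`prm` is a uniformly random permutation of `{0, …, n-1}` independent of the
data, then for every `a > 0`,
`P( max_{1 ≤ t ≤ n} (1/t) ∑_{i<t} |X (prm i)| ≥ 1/a ) ≤ a · E[|X 0| + ⋯ + |X (n-1)|]/n`. -/
theorem permuted_markov_inequality
    {Ω : Type*} [MeasurableSpace Ω] (P : Measure Ω) [IsProbabilityMeasure P]
    (n : ℕ) (hn : 0 < n)
    (X : Fin n → Ω → ℝ)
    (hmeas : ∀ i, Measurable (X i))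
    (hint : ∀ i, Integrable (X i) P)
    (prm : Ω → Equiv.Perm (Fin n))
    (hprm_meas : Measurable prm)
    (hprm_unif : Measure.map prm P = (PMF.uniformOfFintype (Equiv.Perm (Fin n))).toMeasure)
    (hindep : IndepFun (fun ω => fun i : Fin n => X i ω) prm P)
    (a : ℝ) (ha : 0 < a) :
    P {ω | ∃ t : ℕ, 1 ≤ t ∧ t ≤ n ∧
        (t : ℝ)⁻¹ * ∑ i ∈ Finset.univ.filter (fun i : Fin n => (i : ℕ) < t),
          |X (prm ω i) ω| ≥ 1 / a}
      ≤ ENNReal.ofReal (a * (∫ ω, ∑ i, |X i ω| ∂P) / n) := by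
  classical
  -- the bad sets
  let B : Equiv.Perm (Fin n) → Set (Fin n → ℝ) := fun s =>
    {x | ∃ t : ℕ, 1 ≤ t ∧ t ≤ n ∧ (1 / a) * t ≤ pmS (fun i => |x i|) s t}
  have hBm : ∀ s, MeasurableSet (B s) := by
    intro s
    have : B s = ⋃ t : ℕ, {x | 1 ≤ t ∧ t ≤ n ∧ (1 / a) * t ≤ pmS (fun i => |x i|) s t} := by
      ext x
      simp [B]
    rw [this]
    refine MeasurableSet.iUnion fun t => ?_
    refine (MeasurableSet.const _).inter ((MeasurableSet.const _).inter ?_)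
    have hf : Measurable (fun x : Fin n → ℝ => pmS (fun i => |x i|) s t) := by
      unfold pmS
      refine Finset.measurable_sum _ fun i _ => ?_
      exact (measurable_pi_apply (s i)).abs
    exact measurableSet_le (measurable_const (a := (1 / a) * (t : ℝ))) hf
  let Y : Ω → Fin n → ℝ := fun ω i => X i ω
  have hY : Measurable Y := measurable_pi_lambda _ hmeas
  have hsub : {ω | ∃ t : ℕ, 1 ≤ t ∧ t ≤ n ∧
        (t : ℝ)⁻¹ * ∑ i ∈ Finset.univ.filter (fun i : Fin n => (i : ℕ) < t),
          |X (prm ω i) ω| ≥ 1 / a} ⊆ ⋃ s, (Y ⁻¹' (B s) ∩ prm ⁻¹' {s}) := by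
    rintro ω ⟨t, h1, h2, h3⟩
    refine Set.mem_iUnion.2 ⟨prm ω, ⟨t, h1, h2, ?_⟩, rfl⟩
    have ht : (0 : ℝ) < t := by exact_mod_cast h1
    have h4 := mul_le_mul_of_nonneg_right h3 ht.le
    unfold pmS
    refine h4.trans (le_of_eq ?_)
    field_simp
    rfl
  have hp : ∀ s, P (prm ⁻¹' {s}) = (n.factorial : ℝ≥0∞)⁻¹ := by
    intro s
    rw [← Measure.map_apply hprm_meas (MeasurableSpace.measurableSet_top), hprm_unif,
      PMF.toMeasure_apply_singleton _ _ (MeasurableSpace.measurableSet_top)]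
    simp [Fintype.card_perm]
  have hpt : ∀ ω, ∑ s, (Y ⁻¹' (B s)).indicator (fun _ => (1 : ℝ≥0∞)) ω
      ≤ ENNReal.ofReal ((n.factorial : ℝ) * (a / n) * ∑ i, |X i ω|) := by
    intro ω
    have h := pm_comb hn (fun i => |X i ω|) (fun i => abs_nonneg _) (1 / a)
    have hn' : (0 : ℝ) < n := by exact_mod_cast hn
    simp only [Set.indicator_apply, Finset.sum_boole]
    rw [← ENNReal.ofReal_natCast]
    refine ENNReal.ofReal_le_ofReal ?_
    have h5 := mul_le_mul_of_nonneg_left h (div_pos ha hn').le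
    refine le_trans (le_of_eq ?_) (h5.trans (le_of_eq ?_))
    · rw [← mul_assoc, ← mul_assoc]
      have : a / n * n * (1 / a) = 1 := by field_simp
      rw [this, one_mul]
      rfl
    · ring
  have hintsum : Integrable (fun ω => ∑ i, |X i ω|) P :=
    integrable_finsetSum _ fun i _ => (hint i).abs
  have hfac : (0 : ℝ) < n.factorial := by exact_mod_cast n.factorial_pos
  calc _ ≤ P (⋃ s, (Y ⁻¹' (B s) ∩ prm ⁻¹' {s})) := measure_mono hsub
    _ ≤ ∑ s, P (Y ⁻¹' (B s) ∩ prm ⁻¹' {s}) := measure_iUnion_fintype_le _ _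
    _ = ∑ s, P (Y ⁻¹' (B s)) * (n.factorial : ℝ≥0∞)⁻¹ := by
        refine Finset.sum_congr rfl fun s _ => ?_
        rw [hindep.measure_inter_preimage_eq_mul _ _ (hBm s)
          (MeasurableSpace.measurableSet_top), hp]
    _ = (∫⁻ ω, ∑ s, (Y ⁻¹' (B s)).indicator (fun _ => (1 : ℝ≥0∞)) ω ∂P)
          * (n.factorial : ℝ≥0∞)⁻¹ := by
        rw [lintegral_finsetSum _ fun s _ => measurable_const.indicator (hY (hBm s)),
          Finset.sum_mul]
        refine Finset.sum_congr rfl fun s _ => ?_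
        rw [lintegral_indicator (hY (hBm s))]
        simp
    _ ≤ (∫⁻ ω, ENNReal.ofReal ((n.factorial : ℝ) * (a / n) * ∑ i, |X i ω|) ∂P)
          * (n.factorial : ℝ≥0∞)⁻¹ := by
        gcongr with ω
        exact hpt ω
    _ = ENNReal.ofReal (a * (∫ ω, ∑ i, |X i ω| ∂P) / n) := by
        rw [← ofReal_integral_eq_lintegral_ofReal (hintsum.const_mul _)
          (Filter.Eventually.of_forall fun ω => by positivity), integral_const_mul,
          ← ENNReal.ofReal_natCast, ← ENNReal.ofReal_inv_of_pos hfac,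
          ← ENNReal.ofReal_mul' (by positivity)]
        congr 1
        field_simp
end

section
/- Let X_1,…,X_N be integrable real-valued random variables with arbitrary dependence, and let X_{π(1)},…,X_{π(n)} (n ≤ N for sampling without replacement; arbitrary n for sampling with replacement) be obtained by sampling indices uniformly at random, with or without replacement, from {1,…,N}, independently of the values. Then for every a > 0, P( sup_{1 ≤ t ≤ n} (1/t) ∑_{i=1}^t |X_{π(i)}| ≥ 1/a ) ≤ a · E[|X_1| + |X_2| + ⋯ + |X_N|]/N. -/
open MeasureTheory ProbabilityTheory
open scoped ENNReal BigOperators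

lemma smk_swap {N n : ℕ} (x : Fin N → ℝ) (f : Fin n → Fin N) (i j : Fin n) (u : ℕ)
    (hi : (i : ℕ) < u) (hj : (j : ℕ) < u) :
    ∑ k ∈ Finset.univ.filter (fun k : Fin n => (k : ℕ) < u), x ((f ∘ Equiv.swap i j) k)
      = ∑ k ∈ Finset.univ.filter (fun k : Fin n => (k : ℕ) < u), x (f k) := by
  refine Finset.sum_equiv (Equiv.swap i j) ?_ ?_
  · intro k
    simp only [Finset.mem_filter, Finset.mem_univ, true_and]
    rw [Equiv.swap_apply_def]
    split_ifs with h1 h2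
    · subst h1; simp [hi, hj]
    · subst h2; simp [hi, hj]
    · rfl
  · intro k _
    rfl

lemma smk_post {N n : ℕ} (hN : 0 < N) (S : Finset (Fin n → Fin N))
    (hpost : ∀ f ∈ S, ∀ σ : Equiv.Perm (Fin N), σ ∘ f ∈ S) (x : Fin N → ℝ) (i0 : Fin n) :
    (N : ℝ) * ∑ f ∈ S, x (f i0) = S.card * ∑ j, x j := by
  have : NeZero N := ⟨hN.ne'⟩
  have h1 : ∀ k : Fin N, ∑ f ∈ S, x (f i0 + k) = ∑ f ∈ S, x (f i0) := by
    intro k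
    refine Finset.sum_bij' (fun f _ => (Equiv.addRight k) ∘ f)
      (fun f _ => (Equiv.addRight k).symm ∘ f) ?_ ?_ ?_ ?_ ?_
    · intro f hf; exact hpost f hf _
    · intro f hf; exact hpost f hf _
    · intro f hf; funext i; simp
    · intro f hf; funext i; simp
    · intro f hf; simp
  calc (N : ℝ) * ∑ f ∈ S, x (f i0) = ∑ k : Fin N, ∑ f ∈ S, x (f i0 + k) := by
        simp [h1]
    _ = ∑ f ∈ S, ∑ k : Fin N, x (f i0 + k) := Finset.sum_comm
    _ = ∑ f ∈ S, ∑ k : Fin N, x k := by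
        refine Finset.sum_congr rfl fun f _ => ?_
        exact Equiv.sum_comp (Equiv.addLeft (f i0)) x
    _ = _ := by simp

open Classical in
lemma smk_comb {N n : ℕ} (hN : 0 < N) (S : Finset (Fin n → Fin N))
    (hpre : ∀ f ∈ S, ∀ σ : Equiv.Perm (Fin n), f ∘ σ ∈ S)
    (hpost : ∀ f ∈ S, ∀ σ : Equiv.Perm (Fin N), σ ∘ f ∈ S) (x : Fin N → ℝ)
    (hx : ∀ j, 0 ≤ x j) (c : ℝ) :
    (N : ℝ) * (c * (S.filter (fun f => ∃ t : ℕ, 1 ≤ t ∧ t ≤ n ∧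
        (t : ℝ)⁻¹ * ∑ i ∈ Finset.univ.filter (fun i : Fin n => (i : ℕ) < t),
          x (f i) ≥ c)).card) ≤ S.card * ∑ j, x j := by
  rcases Nat.eq_zero_or_pos n with hn | hn
  · have : (S.filter (fun f => ∃ t : ℕ, 1 ≤ t ∧ t ≤ n ∧
        (t : ℝ)⁻¹ * ∑ i ∈ Finset.univ.filter (fun i : Fin n => (i : ℕ) < t),
          x (f i) ≥ c)) = ∅ := by
      refine Finset.filter_false_of_mem ?_
      rintro f _ ⟨t, h1, h2, _⟩
      omega
    rw [this]
    have := Finset.sum_nonneg (fun j (_ : j ∈ Finset.univ) => hx j)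
    simp only [Finset.card_empty, Nat.cast_zero, mul_zero]
    positivity
  set i0 : Fin n := ⟨0, hn⟩ with hi0
  rw [← smk_post hN S hpost x i0]
  refine mul_le_mul_of_nonneg_left ?_ (Nat.cast_nonneg _)
  let A : ℕ → (Fin n → Fin N) → ℝ := fun t f =>
    (t : ℝ)⁻¹ * ∑ i ∈ Finset.univ.filter (fun i : Fin n => (i : ℕ) < t), x (f i)
  let T : ℕ → Finset (Fin n → Fin N) := fun t =>
    S.filter (fun f => c ≤ A t f ∧ ∀ u, t < u → u ≤ n → A u f < c)
  have hdisj : (↑(Finset.Icc 1 n) : Set ℕ).PairwiseDisjoint T := by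
    intro t ht u hu htu
    rw [Function.onFun, Finset.disjoint_left]
    intro f h1 h2
    simp only [T, Finset.mem_filter] at h1 h2
    simp only [Finset.coe_Icc, Set.mem_Icc] at ht hu
    rcases lt_or_gt_of_ne htu with h | h
    · exact absurd (h1.2.2 u h hu.2) (not_lt.2 h2.2.1)
    · exact absurd (h2.2.2 t h ht.2) (not_lt.2 h1.2.1)
  have hsub : (S.filter (fun f => ∃ t : ℕ, 1 ≤ t ∧ t ≤ n ∧
        (t : ℝ)⁻¹ * ∑ i ∈ Finset.univ.filter (fun i : Fin n => (i : ℕ) < t),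
          x (f i) ≥ c)) = (Finset.Icc 1 n).biUnion T := by
    ext f
    simp only [Finset.mem_filter, Finset.mem_biUnion, Finset.mem_Icc, T]
    constructor
    · rintro ⟨hf, t, h1, h2, h3⟩
      let M := (Finset.Icc 1 n).filter (fun t => c ≤ A t f)
      have hM : M.Nonempty := ⟨t, by simp only [M, Finset.mem_filter, Finset.mem_Icc]; exact ⟨⟨h1, h2⟩, h3⟩⟩
      have hmem := M.max'_mem hM
      have hmem' := hmem
      simp only [M, Finset.mem_filter, Finset.mem_Icc] at hmem'
      refine ⟨M.max' hM, hmem'.1, hf, hmem'.2, fun u hu hun => ?_⟩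
      by_contra hcon
      have : u ∈ M := by
        simp only [M, Finset.mem_filter, Finset.mem_Icc]
        exact ⟨⟨by omega, hun⟩, not_lt.1 hcon⟩
      exact absurd (M.le_max' u this) (not_le.2 hu)
    · rintro ⟨t, ⟨h1, h2⟩, hf, h3, _⟩
      exact ⟨hf, t, h1, h2, h3⟩
  have key : ∀ t ∈ Finset.Icc 1 n, c * (T t).card ≤ ∑ f ∈ T t, x (f i0) := by
    intro t ht
    rw [Finset.mem_Icc] at ht
    have hsw : ∀ i : Fin n, (i : ℕ) < t → ∑ f ∈ T t, x (f i) = ∑ f ∈ T t, x (f i0) := by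
      intro i hi
      have hmem : ∀ f ∈ T t, f ∘ Equiv.swap i i0 ∈ T t := by
        intro f hf
        simp only [T, Finset.mem_filter] at hf ⊢
        have e : ∀ u, t ≤ u → A u (f ∘ Equiv.swap i i0) = A u f := by
          intro u hu
          simp only [A]
          rw [smk_swap x f i i0 u (by omega) (by simp only [hi0]; omega)]
        refine ⟨hpre f hf.1 _, ?_, ?_⟩
        · rw [e t le_rfl]; exact hf.2.1
        · intro u hu hun
          rw [e u hu.le]; exact hf.2.2 u hu hun
      refine Finset.sum_bij' (fun f _ => f ∘ Equiv.swap i i0)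
        (fun f _ => f ∘ Equiv.swap i i0) hmem hmem ?_ ?_ ?_
      · intro f hf; funext k; simp
      · intro f hf; funext k; simp
      · intro f hf; simp
    have hcard : (Finset.univ.filter (fun i : Fin n => (i : ℕ) < t)).card = t := by
      rw [Fin.card_filter_val_lt]; omega
    have ht0 : (t : ℝ) ≠ 0 := by
      have : t ≠ 0 := by omega
      exact_mod_cast this
    calc c * (T t).card = ∑ f ∈ T t, c := by simp [mul_comm]
      _ ≤ ∑ f ∈ T t, A t f := Finset.sum_le_sum fun f hf => by
          simp only [T, Finset.mem_filter] at hf; exact hf.2.1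
      _ = (t : ℝ)⁻¹ * ∑ i ∈ Finset.univ.filter (fun i : Fin n => (i : ℕ) < t),
            ∑ f ∈ T t, x (f i) := by
          simp only [A]
          rw [← Finset.mul_sum, Finset.sum_comm]
      _ = (t : ℝ)⁻¹ * ∑ i ∈ Finset.univ.filter (fun i : Fin n => (i : ℕ) < t),
            ∑ f ∈ T t, x (f i0) := by
          congr 1
          refine Finset.sum_congr rfl fun i hi => hsw i ?_
          simpa using hi
      _ = ∑ f ∈ T t, x (f i0) := by
          rw [Finset.sum_const, hcard, nsmul_eq_mul, ← mul_assoc, inv_mul_cancel₀ ht0, one_mul]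
  rw [hsub, Finset.card_biUnion hdisj, Nat.cast_sum, Finset.mul_sum]
  calc ∑ t ∈ Finset.Icc 1 n, c * ((T t).card : ℝ)
      ≤ ∑ t ∈ Finset.Icc 1 n, ∑ f ∈ T t, x (f i0) := Finset.sum_le_sum key
    _ = ∑ f ∈ (Finset.Icc 1 n).biUnion T, x (f i0) := (Finset.sum_biUnion hdisj).symm
    _ ≤ ∑ f ∈ S, x (f i0) := by
        refine Finset.sum_le_sum_of_subset_of_nonneg ?_ (fun f _ _ => hx _)
        rw [← hsub]; exact Finset.filter_subset _ _

lemma smk_main {Ω : Type*} [MeasurableSpace Ω] (P : Measure Ω) [IsProbabilityMeasure P]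
    (N n : ℕ) (hN : 0 < N)
    (X : Fin N → Ω → ℝ)
    (hmeas : ∀ j, Measurable (X j))
    (hint : ∀ j, Integrable (X j) P)
    (s : Ω → (Fin n → Fin N))
    (hs_meas : Measurable s)
    (S : Finset (Fin n → Fin N)) (hne : S.Nonempty)
    (hpre : ∀ f ∈ S, ∀ σ : Equiv.Perm (Fin n), f ∘ σ ∈ S)
    (hpost : ∀ f ∈ S, ∀ σ : Equiv.Perm (Fin N), σ ∘ f ∈ S)
    (hs_law : Measure.map s P = (PMF.uniformOfFinset S hne).toMeasure)
    (hindep : IndepFun (fun ω => fun j : Fin N => X j ω) s P)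
    (a : ℝ) (ha : 0 < a) :
    P {ω | ∃ t : ℕ, 1 ≤ t ∧ t ≤ n ∧
        (t : ℝ)⁻¹ * ∑ i ∈ Finset.univ.filter (fun i : Fin n => (i : ℕ) < t),
          |X (s ω i) ω| ≥ 1 / a}
      ≤ ENNReal.ofReal (a * (∫ ω, ∑ j, |X j ω| ∂P) / N) := by
  classical
  let B : (Fin n → Fin N) → Set (Fin N → ℝ) := fun f => {x | ∃ t : ℕ, 1 ≤ t ∧ t ≤ n ∧
        (t : ℝ)⁻¹ * ∑ i ∈ Finset.univ.filter (fun i : Fin n => (i : ℕ) < t),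
          |x (f i)| ≥ 1 / a}
  have hB : ∀ f, MeasurableSet (B f) := by
    intro f
    have : B f = ⋃ t : ℕ, {x | 1 ≤ t ∧ t ≤ n ∧
        (t : ℝ)⁻¹ * ∑ i ∈ Finset.univ.filter (fun i : Fin n => (i : ℕ) < t),
          |x (f i)| ≥ 1 / a} := by
      ext x; simp [B]
    rw [this]
    refine MeasurableSet.iUnion fun t => ?_
    refine MeasurableSet.inter (MeasurableSet.const _) (MeasurableSet.inter (MeasurableSet.const _) ?_)
    have hm : Measurable (fun x : Fin N → ℝ =>
        (t : ℝ)⁻¹ * ∑ i ∈ Finset.univ.filter (fun i : Fin n => (i : ℕ) < t), |x (f i)|) := by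
      refine Measurable.const_mul (Finset.measurable_sum _ fun i _ => ?_) _
      exact (measurable_pi_apply (f i)).abs
    exact measurableSet_le (measurable_const (a := 1 / a)) hm
  let Y : Ω → Fin N → ℝ := fun ω j => X j ω
  have hY : Measurable Y := measurable_pi_lambda _ hmeas
  have hlaw : ∀ f, P (s ⁻¹' {f}) = if f ∈ S then (S.card : ℝ≥0∞)⁻¹ else 0 := by
    intro f
    rw [← Measure.map_apply hs_meas (measurableSet_singleton f), hs_law,
      PMF.toMeasure_apply_singleton _ _ (measurableSet_singleton f), PMF.uniformOfFinset_apply]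
    split_ifs <;> rfl
  have hcov : {ω | ∃ t : ℕ, 1 ≤ t ∧ t ≤ n ∧
        (t : ℝ)⁻¹ * ∑ i ∈ Finset.univ.filter (fun i : Fin n => (i : ℕ) < t),
          |X (s ω i) ω| ≥ 1 / a} ⊆ ⋃ f ∈ (Finset.univ : Finset (Fin n → Fin N)),
            (Y ⁻¹' (B f) ∩ s ⁻¹' {f}) := by
    intro ω hω
    simp only [Set.mem_iUnion]
    exact ⟨s ω, Finset.mem_univ _, hω, rfl⟩
  have hScard : (0 : ℝ) < S.card := by exact_mod_cast hne.card_pos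
  have hNr : (0 : ℝ) < N := by exact_mod_cast hN
  have hI : Integrable (fun ω => ∑ j, |X j ω|) P :=
    integrable_finsetSum _ fun j _ => (hint j).abs
  have hpt : ∀ ω, ∑ f ∈ S, (Y ⁻¹' (B f)).indicator (fun _ => (1 : ℝ≥0∞)) ω
      ≤ ENNReal.ofReal (S.card * (a * (∑ j, |X j ω|) / N)) := by
    intro ω
    have h := smk_comb hN S hpre hpost (fun j => |X j ω|) (fun j => abs_nonneg _) (1 / a)
    have e : ∑ f ∈ S, (Y ⁻¹' (B f)).indicator (fun _ => (1 : ℝ≥0∞)) ω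
        = ((S.filter (fun f => Y ω ∈ B f)).card : ℝ≥0∞) := by
      rw [Finset.card_filter]
      push_cast
      refine Finset.sum_congr rfl fun f _ => ?_
      simp [Set.indicator_apply]
    rw [e, ← ENNReal.ofReal_natCast]
    refine ENNReal.ofReal_le_ofReal ?_
    have h' : (N : ℝ) * (1 / a * ((S.filter (fun f => Y ω ∈ B f)).card : ℝ))
        ≤ S.card * ∑ j, |X j ω| := by
      convert h using 5
      ext f
      simp only [Finset.mem_filter]
      rfl
    have e2 : (S.card : ℝ) * (a * (∑ j, |X j ω|) / N) = (S.card * ∑ j, |X j ω|) * (a / N) := by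
      ring
    rw [e2]
    calc ((S.filter (fun f => Y ω ∈ B f)).card : ℝ)
        = ((N : ℝ) * (1 / a * ((S.filter (fun f => Y ω ∈ B f)).card : ℝ))) * (a / N) := by
          field_simp
      _ ≤ _ := mul_le_mul_of_nonneg_right h' (by positivity)
  have hsum : ∑ f ∈ S, P (Y ⁻¹' (B f))
      ≤ S.card * ENNReal.ofReal (a * (∫ ω, ∑ j, |X j ω| ∂P) / N) := by
    calc ∑ f ∈ S, P (Y ⁻¹' (B f))
        = ∑ f ∈ S, ∫⁻ ω, (Y ⁻¹' (B f)).indicator (fun _ => (1 : ℝ≥0∞)) ω ∂P := by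
          refine Finset.sum_congr rfl fun f _ => ?_
          rw [lintegral_indicator (hY (hB f))]; simp
      _ = ∫⁻ ω, ∑ f ∈ S, (Y ⁻¹' (B f)).indicator (fun _ => (1 : ℝ≥0∞)) ω ∂P := by
          rw [lintegral_finsetSum]
          intro f _
          exact measurable_const.indicator (hY (hB f))
      _ ≤ ∫⁻ ω, ENNReal.ofReal (S.card * (a * (∑ j, |X j ω|) / N)) ∂P := lintegral_mono hpt
      _ = ENNReal.ofReal (∫ ω, S.card * (a * (∑ j, |X j ω|) / N) ∂P) := by
          rw [ofReal_integral_eq_lintegral_ofReal]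
          · exact ((hI.const_mul a).div_const _).const_mul _
          · refine Filter.Eventually.of_forall fun ω => ?_
            have := Finset.sum_nonneg (fun j (_ : j ∈ Finset.univ) => abs_nonneg (X j ω))
            simp only [Pi.zero_apply]
            positivity
      _ = _ := by
          rw [integral_const_mul, integral_div, integral_const_mul,
            ENNReal.ofReal_mul hScard.le, ENNReal.ofReal_natCast]
  calc _ ≤ P (⋃ f ∈ (Finset.univ : Finset (Fin n → Fin N)), (Y ⁻¹' (B f) ∩ s ⁻¹' {f})) :=
        measure_mono hcov
    _ ≤ ∑ f, P (Y ⁻¹' (B f) ∩ s ⁻¹' {f}) := measure_biUnion_finset_le _ _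
    _ = ∑ f, P (Y ⁻¹' (B f)) * P (s ⁻¹' {f}) := Finset.sum_congr rfl fun f _ =>
        hindep.measure_inter_preimage_eq_mul _ _ (hB f) (measurableSet_singleton f)
    _ = (∑ f ∈ S, P (Y ⁻¹' (B f))) * (S.card : ℝ≥0∞)⁻¹ := by
        simp only [hlaw, mul_ite, mul_zero]
        rw [Finset.sum_ite_mem, Finset.univ_inter, Finset.sum_mul]
    _ ≤ (S.card * ENNReal.ofReal (a * (∫ ω, ∑ j, |X j ω| ∂P) / N)) * (S.card : ℝ≥0∞)⁻¹ := by
        gcongr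
    _ = _ := by
        rw [mul_comm, ← mul_assoc, ENNReal.inv_mul_cancel, one_mul]
        · exact_mod_cast hne.card_pos.ne'
        · exact ENNReal.natCast_ne_top _

/-- **Sampling corollary of the exchangeable Markov inequality.** Let
`X 0, …, X (N-1)` be arbitrarily dependent integrable random variables ("a bag"),
and let `s : Ω → (Fin n → Fin N)` be the random indices of `n` draws from the bag,
sampled uniformly at random with replacement (law uniform on all functions
`Fin n → Fin N`) or without replacement (law uniform on the injective functions),
independently of the values. Then for every `a > 0`,
`P( max_{1 ≤ t ≤ n} (1/t) ∑_{i<t} |X (s i)| ≥ 1/a ) ≤ a · E[|X 0| + ⋯ + |X (N-1)|]/N`. -/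
theorem sampled_markov_inequality
    {Ω : Type*} [MeasurableSpace Ω] (P : Measure Ω) [IsProbabilityMeasure P]
    (N n : ℕ) (hN : 0 < N)
    (X : Fin N → Ω → ℝ)
    (hmeas : ∀ j, Measurable (X j))
    (hint : ∀ j, Integrable (X j) P)
    (s : Ω → (Fin n → Fin N))
    (hs_meas : Measurable s)
    (hs_law :
      (∃ hne : (Finset.univ : Finset (Fin n → Fin N)).Nonempty,
          Measure.map s P = (PMF.uniformOfFinset Finset.univ hne).toMeasure)
      ∨ (∃ hne : (Finset.univ.filter fun f : Fin n → Fin N => Function.Injective f).Nonempty,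
          Measure.map s P =
            (PMF.uniformOfFinset
              (Finset.univ.filter fun f : Fin n → Fin N => Function.Injective f) hne).toMeasure))
    (hindep : IndepFun (fun ω => fun j : Fin N => X j ω) s P)
    (a : ℝ) (ha : 0 < a) :
    P {ω | ∃ t : ℕ, 1 ≤ t ∧ t ≤ n ∧
        (t : ℝ)⁻¹ * ∑ i ∈ Finset.univ.filter (fun i : Fin n => (i : ℕ) < t),
          |X (s ω i) ω| ≥ 1 / a}
      ≤ ENNReal.ofReal (a * (∫ ω, ∑ j, |X j ω| ∂P) / N) := by
  rcases hs_law with ⟨hne, h⟩ | ⟨hne, h⟩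
  · exact smk_main P N n hN X hmeas hint s hs_meas _ hne (fun _ _ _ => Finset.mem_univ _)
      (fun _ _ _ => Finset.mem_univ _) h hindep a ha
  · refine smk_main P N n hN X hmeas hint s hs_meas _ hne ?_ ?_ h hindep a ha
    · intro f hf σ
      simp only [Finset.mem_filter, Finset.mem_univ, true_and] at hf ⊢
      exact hf.comp σ.injective
    · intro f hf σ
      simp only [Finset.mem_filter, Finset.mem_univ, true_and] at hf ⊢
      exact σ.injective.comp hf
end

section
/- Let X be a nonnegative random variable and U an independent random variable uniformly distributed on [0,1]. Then for any a > 0: (i) P(X ≥ U/a) = E[min(aX, 1)] ≤ a·E[X] (with the equality holding even when X is not integrable); (ii) if instead U is only stochastically larger than uniform on [0,1], then P(X ≥ U/a) ≤ E[min(aX,1)] ≤ a·E[X]; (iii) if moreover X ∈ [0, C] almost surely for some C > 0, then P(X ≥ U/a) = a·E[X] for any a ≤ 1/C when U is uniform on [0,1]. -/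
open MeasureTheory ProbabilityTheory
open scoped ENNReal

theorem umi_aux_prob {Ω : Type*} [MeasurableSpace Ω] (P : Measure Ω) [IsProbabilityMeasure P]
    (X V : Ω → ℝ) (hX : Measurable X) (hV : Measurable V) (hindep : IndepFun X V P)
    (a : ℝ) (ha : 0 < a) :
    P {ω | X ω ≥ V ω / a} = ∫⁻ ω, P {ω' | V ω' ≤ a * X ω} ∂P := by
  have hs : MeasurableSet {p : ℝ × ℝ | p.2 ≤ a * p.1} :=
    measurableSet_le measurable_snd (measurable_fst.const_mul a)
  have h1 : {ω | X ω ≥ V ω / a} = (fun ω => (X ω, V ω)) ⁻¹' {p : ℝ × ℝ | p.2 ≤ a * p.1} := by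
    ext ω
    simp only [Set.mem_setOf_eq, Set.mem_preimage, ge_iff_le]
    rw [div_le_iff₀ ha, mul_comm]
  have : IsProbabilityMeasure (P.map V) := Measure.isProbabilityMeasure_map hV.aemeasurable
  rw [h1, ← Measure.map_apply (hX.prodMk hV) hs,
    (indepFun_iff_map_prod_eq_prod_map_map hX.aemeasurable hV.aemeasurable).1 hindep,
    Measure.prod_apply hs, lintegral_map (measurable_measure_prodMk_left hs) hX]
  refine lintegral_congr fun ω => ?_
  rw [Measure.map_apply hV (measurable_prodMk_left hs)]
  rfl

theorem umi_aux_min {Ω : Type*} [MeasurableSpace Ω] (P : Measure Ω) [IsProbabilityMeasure P]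
    (X : Ω → ℝ) (hX : Measurable X) (hXnn : ∀ ω, 0 ≤ X ω) (a : ℝ) (ha : 0 < a) :
    ENNReal.ofReal (∫ ω, min (a * X ω) 1 ∂P) = ∫⁻ ω, ENNReal.ofReal (min (a * X ω) 1) ∂P := by
  have hnn : ∀ ω, 0 ≤ min (a * X ω) 1 := fun ω => le_min (mul_nonneg ha.le (hXnn ω)) zero_le_one
  refine ofReal_integral_eq_lintegral_ofReal ?_ (Filter.Eventually.of_forall hnn)
  refine Integrable.of_bound ((hX.const_mul a).min measurable_const).aestronglyMeasurable 1
    (Filter.Eventually.of_forall fun ω => ?_)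
  rw [Real.norm_of_nonneg (hnn ω)]
  exact min_le_right _ _

/-- **Uniformly-randomized Markov inequality (UMI).** Let `X ≥ 0` and let `U` be
uniform on `[0,1]`, independent of `X`. Then for any `a > 0`:
(i) `P(X ≥ U/a) = E[min(aX,1)] ≤ a·E[X]` (the equality holds even when `X` is not
integrable; accordingly `a·E[X]` is expressed via the Lebesgue integral);
(ii) if `V` is independent of `X` and only stochastically larger than uniform on
`[0,1]`, then `P(X ≥ V/a) ≤ E[min(aX,1)]`;
(iii) if moreover `X ≤ C` a.s. for some `C > 0` and `a ≤ 1/C`, then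
`P(X ≥ U/a) = a·E[X]`. -/
theorem uniformly_randomized_markov_inequality
    {Ω : Type*} [MeasurableSpace Ω] (P : Measure Ω) [IsProbabilityMeasure P]
    (X U : Ω → ℝ) (hXmeas : Measurable X) (hUmeas : Measurable U)
    (hXnn : ∀ ω, 0 ≤ X ω)
    (hindep : IndepFun X U P)
    (hU : ∀ u ∈ Set.Icc (0 : ℝ) 1, P {ω | U ω ≤ u} = ENNReal.ofReal u)
    (a : ℝ) (ha : 0 < a) :
    (P {ω | X ω ≥ U ω / a} = ENNReal.ofReal (∫ ω, min (a * X ω) 1 ∂P)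
      ∧ ENNReal.ofReal (∫ ω, min (a * X ω) 1 ∂P)
          ≤ ENNReal.ofReal a * ∫⁻ ω, ENNReal.ofReal (X ω) ∂P)
    ∧ (∀ V : Ω → ℝ, Measurable V → IndepFun X V P →
        (∀ u ∈ Set.Icc (0 : ℝ) 1, P {ω | V ω ≤ u} ≤ ENNReal.ofReal u) →
        P {ω | X ω ≥ V ω / a} ≤ ENNReal.ofReal (∫ ω, min (a * X ω) 1 ∂P))
    ∧ (∀ C : ℝ, 0 < C → (∀ᵐ ω ∂P, X ω ≤ C) → a ≤ 1 / C →
        P {ω | X ω ≥ U ω / a} = ENNReal.ofReal (a * ∫ ω, X ω ∂P)) := by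
  have hmin := umi_aux_min P X hXmeas hXnn a ha
  have hle : ∀ V : Ω → ℝ, Measurable V → IndepFun X V P →
        (∀ u ∈ Set.Icc (0 : ℝ) 1, P {ω | V ω ≤ u} ≤ ENNReal.ofReal u) →
        P {ω | X ω ≥ V ω / a} ≤ ENNReal.ofReal (∫ ω, min (a * X ω) 1 ∂P) := by
    intro V hV hi hVu
    rw [hmin, umi_aux_prob P X V hXmeas hV hi a ha]
    refine lintegral_mono fun ω => ?_
    rcases le_total (a * X ω) 1 with h | h
    · simp only [min_eq_left h]
      exact hVu _ ⟨mul_nonneg ha.le (hXnn ω), h⟩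
    · simp only [min_eq_right h, ENNReal.ofReal_one]
      exact prob_le_one
  have heq : P {ω | X ω ≥ U ω / a} = ENNReal.ofReal (∫ ω, min (a * X ω) 1 ∂P) := by
    refine le_antisymm (hle U hUmeas hindep fun u hu => (hU u hu).le) ?_
    rw [hmin, umi_aux_prob P X U hXmeas hUmeas hindep a ha]
    refine lintegral_mono fun ω => ?_
    rw [← hU _ ⟨le_min (mul_nonneg ha.le (hXnn ω)) zero_le_one, min_le_right _ _⟩]
    exact measure_mono fun ω' (h : U ω' ≤ min (a * X ω) 1) => h.trans (min_le_left _ _)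
  refine ⟨⟨heq, ?_⟩, hle, ?_⟩
  · rw [hmin, ← lintegral_const_mul _ hXmeas.ennreal_ofReal]
    refine lintegral_mono fun ω => ?_
    rw [← ENNReal.ofReal_mul ha.le]
    exact ENNReal.ofReal_le_ofReal (min_le_left _ _)
  · intro C hC hXC haC
    rw [heq, ← integral_const_mul]
    congr 1
    refine integral_congr_ae ?_
    filter_upwards [hXC] with ω hω
    refine min_eq_left ?_
    calc a * X ω ≤ a * C := mul_le_mul_of_nonneg_left hω ha.le
      _ ≤ 1 := (le_div_iff₀ hC).1 haC
end

section
/- Let ε > 0, let X be a nonnegative integrable random variable, and let A be uniformly distributed on (0, ε) and independent of X. Then P(X ≥ ε − A) ≤ E[X]/ε. -/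
open MeasureTheory ProbabilityTheory
open scoped ENNReal

/-- **Additively-randomized Markov inequality (AMI).** Let `ε > 0`, let `X ≥ 0`
be integrable, and let `A` be uniformly distributed on `(0, ε)` (characterized by
its CDF: `P(A ≤ u) = u/ε` for `u ∈ [0, ε]`), independent of `X`. Then
`P(X ≥ ε − A) ≤ E[X]/ε`. -/
theorem additively_randomized_markov_inequality
    {Ω : Type*} [MeasurableSpace Ω] (P : Measure Ω) [IsProbabilityMeasure P]
    (ε : ℝ) (hε : 0 < ε)
    (X A : Ω → ℝ) (hXmeas : Measurable X) (hAmeas : Measurable A)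
    (hXnn : ∀ ω, 0 ≤ X ω)
    (hXint : Integrable X P)
    (hindep : IndepFun X A P)
    (hA : ∀ u ∈ Set.Icc (0 : ℝ) ε, P {ω | A ω ≤ u} = ENNReal.ofReal (u / ε)) :
    P {ω | X ω ≥ ε - A ω} ≤ ENNReal.ofReal ((∫ ω, X ω ∂P) / ε) := by
  have key : ∀ x : ℝ, 0 ≤ x → P {ω | ε - x ≤ A ω} ≤ ENNReal.ofReal (x / ε) := by
    intro x hx
    rcases le_or_gt ε x with h | h
    · refine prob_le_one.trans ?_
      rw [ENNReal.one_le_ofReal]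
      exact (one_le_div hε).2 h
    · have hb : ∀ δ : ℝ, 0 < δ → δ ≤ ε - x →
          P {ω | ε - x ≤ A ω} ≤ ENNReal.ofReal ((x + δ) / ε) := by
        intro δ hδ hδ'
        have hm : MeasurableSet {ω | A ω ≤ ε - x - δ} := measurableSet_le hAmeas measurable_const
        have hsub : {ω | ε - x ≤ A ω} ⊆ {ω | A ω ≤ ε - x - δ}ᶜ := by
          intro ω hω
          simp only [Set.mem_setOf_eq, Set.mem_compl_iff, not_le] at *
          linarith
        refine (measure_mono hsub).trans ?_
        rw [prob_compl_eq_one_sub hm, hA _ ⟨by linarith, by linarith⟩, ← ENNReal.ofReal_one,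
          ← ENNReal.ofReal_sub _ (div_nonneg (by linarith) hε.le)]
        apply le_of_eq
        congr 1
        field_simp
        ring
      have ht : Filter.Tendsto (fun δ : ℝ => ENNReal.ofReal ((x + δ) / ε))
          (nhdsWithin 0 (Set.Ioi 0)) (nhds (ENNReal.ofReal (x / ε))) := by
        have hc : Continuous (fun δ : ℝ => ENNReal.ofReal ((x + δ) / ε)) :=
          ENNReal.continuous_ofReal.comp (by fun_prop)
        have := hc.tendsto 0
        simp only [add_zero] at this
        exact this.mono_left nhdsWithin_le_nhds
      refine ge_of_tendsto ht ?_
      filter_upwards [Ioc_mem_nhdsGT (sub_pos.2 h)] with δ hδ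
      exact hb δ hδ.1 hδ.2
  have hS : MeasurableSet {p : ℝ × ℝ | p.1 ≥ ε - p.2} :=
    measurableSet_le (by fun_prop) (by fun_prop)
  have hmap := (indepFun_iff_map_prod_eq_prod_map_map hXmeas.aemeasurable hAmeas.aemeasurable).1
    hindep
  have : IsProbabilityMeasure (P.map A) := Measure.isProbabilityMeasure_map hAmeas.aemeasurable
  calc P {ω | X ω ≥ ε - A ω}
      = (P.map fun ω => (X ω, A ω)) {p : ℝ × ℝ | p.1 ≥ ε - p.2} := by
        rw [Measure.map_apply (hXmeas.prodMk hAmeas) hS]; rfl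
    _ = ∫⁻ ω, (P.map A) (Prod.mk (X ω) ⁻¹' {p : ℝ × ℝ | p.1 ≥ ε - p.2}) ∂P := by
        rw [hmap, Measure.prod_apply hS, lintegral_map (measurable_measure_prodMk_left hS) hXmeas]
    _ ≤ ∫⁻ ω, ENNReal.ofReal (X ω / ε) ∂P := by
        refine lintegral_mono fun ω => ?_
        rw [Measure.map_apply hAmeas (measurable_prodMk_left hS)]
        refine le_trans (measure_mono ?_) (key (X ω) (hXnn ω))
        intro ω' h
        simp only [Set.mem_preimage, Set.mem_setOf_eq] at *
        linarith
    _ = ENNReal.ofReal ((∫ ω, X ω ∂P) / ε) := by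
        rw [← ofReal_integral_eq_lintegral_ofReal (hXint.div_const ε)
          (Filter.Eventually.of_forall fun ω => div_nonneg (hXnn ω) hε.le), integral_div]
end

section
/- Let M = (M_t)_{t≥0} be a nonnegative supermartingale with respect to a filtration F = (F_t)_{t≥0} with E[M_0] ≤ 1, let τ be any F-stopping time (possibly infinite), and let U be a random variable independent of F (hence of M and τ) that is uniformly distributed on [0,1] or stochastically larger than uniform on [0,1]. Then for any a > 0, P(M_τ ≥ U/a) ≤ a. -/
open MeasureTheory ProbabilityTheory Filter
open scoped ENNReal

/-- **Randomized Ville inequality at a stopping time.** Let `M` be a nonnegative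
supermartingale with respect to a filtration `F` with `E[M 0] ≤ 1`, let `τ` be an
`F`-stopping time with values in `ℕ ∪ {∞}`, and on `{τ = ∞}` interpret `M_τ` via
the almost sure limit `Mlim` of the process. Let `U` be independent of `F` and
stochastically larger than uniform on `[0,1]` (i.e. `P(U ≤ u) ≤ u` for
`u ∈ [0,1]`, which covers the exactly uniform case). Then for any `a > 0`,
`P(M_τ ≥ U/a) ≤ a`. -/
theorem randomized_ville_inequality
    {Ω : Type*} [m0 : MeasurableSpace Ω] (P : Measure Ω) [IsProbabilityMeasure P]
    (F : Filtration ℕ m0) (M : ℕ → Ω → ℝ)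
    (hsuper : Supermartingale M F P)
    (hnn : ∀ t ω, 0 ≤ M t ω)
    (hM0 : ∫ ω, M 0 ω ∂P ≤ 1)
    (τ : Ω → ℕ∞)
    (hτ : ∀ t : ℕ, MeasurableSet[F t] {ω | τ ω ≤ (t : ℕ∞)})
    (Mlim : Ω → ℝ)
    (hMlim : ∀ᵐ ω ∂P, Tendsto (fun t => M t ω) atTop (nhds (Mlim ω)))
    (U : Ω → ℝ) (hUmeas : Measurable U)
    (hindep : Indep (⨆ t, (F t : MeasurableSpace Ω))
      (MeasurableSpace.comap U inferInstance) P)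
    (hU : ∀ u ∈ Set.Icc (0 : ℝ) 1, P {ω | U ω ≤ u} ≤ ENNReal.ofReal u)
    (a : ℝ) (ha : 0 < a) :
    P {ω | (if τ ω = ⊤ then Mlim ω else M ((τ ω).toNat) ω) ≥ U ω / a}
      ≤ ENNReal.ofReal a := by
  have hst : IsStoppingTime F τ := hτ
  have hsub := hsuper.neg.stoppedProcess hst
  -- the stopped process
  set X : ℕ → Ω → ℝ := stoppedProcess M τ with hX
  have hneg : stoppedProcess (-M) τ = -X := rfl
  rw [hneg] at hsub
  have hXnn : ∀ n ω, 0 ≤ X n ω := fun n ω => hnn _ ω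
  have hXsup : Supermartingale X F P := by simpa using hsub.neg
  have hX0 : X 0 = M 0 := by
    funext ω
    exact stoppedProcess_eq_of_le (by exact zero_le (a := τ ω))
  have hXint : ∀ n, ∫ ω, X n ω ∂P ≤ 1 := by
    intro n
    have h := hXsup.setIntegral_le (Nat.zero_le n) MeasurableSet.univ
    rw [setIntegral_univ, setIntegral_univ, hX0] at h
    exact h.trans hM0
  have hXlint : ∀ n, ∫⁻ ω, ENNReal.ofReal (X n ω) ∂P ≤ 1 := by
    intro n
    rw [← ofReal_integral_eq_lintegral_ofReal (hXsup.integrable n)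
      (Eventually.of_forall (hXnn n))]
    exact ENNReal.ofReal_le_one.2 (hXint n)
  -- the limit
  let L : Ω → ℝ≥0∞ := fun ω => liminf (fun n => ENNReal.ofReal (X n ω)) atTop
  have hle : (⨆ t, (F t : MeasurableSpace Ω)) ≤ m0 := iSup_le F.le
  have hLm' : Measurable[⨆ t, (F t : MeasurableSpace Ω)] L := by
    refine Measurable.liminf (mδ := _) fun n => ?_
    have h1 : Measurable[F n] (X n) := (hXsup.stronglyAdapted n).measurable
    exact ENNReal.measurable_ofReal.comp (h1.mono (le_iSup (fun t => F t) n) le_rfl)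
  have hLm : Measurable L := hLm'.mono hle le_rfl
  have hLint : ∫⁻ ω, L ω ∂P ≤ 1 := by
    refine (lintegral_liminf_le fun n => ?_).trans ?_
    · exact ENNReal.measurable_ofReal.comp
        ((hXsup.stronglyAdapted n).measurable.mono (F.le n) le_rfl)
    · refine (liminf_le_liminf (Eventually.of_forall hXlint)).trans ?_
      simp
  have hLeq : ∀ᵐ ω ∂P, (L ω).toReal
      = (if τ ω = ⊤ then Mlim ω else M ((τ ω).toNat) ω) := by
    filter_upwards [hMlim] with ω hω
    have key : Tendsto (fun n => X n ω) atTop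
        (nhds (if τ ω = ⊤ then Mlim ω else M ((τ ω).toNat) ω)) := by
      split_ifs with h
      · refine hω.congr fun n => ?_
        exact (stoppedProcess_eq_of_le (by rw [h]; exact le_top)).symm
      · refine tendsto_const_nhds.congr' ?_
        filter_upwards [eventually_ge_atTop (τ ω).toNat] with n hn
        have h2 : τ ω ≤ (n : ℕ∞) := by
          rw [← ENat.natCast_toNat h]; exact_mod_cast hn
        have h3 : X n ω = M (τ ω).untopA ω := stoppedProcess_eq_of_ge h2
        rw [h3]
        congr 1
        obtain ⟨k, hk⟩ := ENat.ne_top_iff_exists.1 h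
        rw [← hk]
        rfl
    have h0 := ge_of_tendsto' key (fun n => hXnn n ω)
    have h4 := (ENNReal.tendsto_ofReal key).liminf_eq
    change (liminf (fun n => ENNReal.ofReal (X n ω)) atTop).toReal = _
    rw [h4, ENNReal.toReal_ofReal h0]
  let Y : Ω → ℝ := fun ω => (L ω).toReal * a
  have hYm' : Measurable[⨆ t, (F t : MeasurableSpace Ω)] Y :=
    (ENNReal.measurable_toReal.comp hLm').mul_const a
  have hYm : Measurable Y := hYm'.mono hle le_rfl
  have hYU : IndepFun Y U P := by
    rw [IndepFun_iff_Indep]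
    exact indep_of_indep_of_le_left hindep hYm'.comap_le
  have hS : MeasurableSet {p : ℝ × ℝ | p.2 ≤ p.1} := measurableSet_le measurable_snd measurable_fst
  have hmap := (indepFun_iff_map_prod_eq_prod_map_map hYm.aemeasurable hUmeas.aemeasurable).1 hYU
  have hU' : ∀ y : ℝ, 0 ≤ y → P {ω | U ω ≤ y} ≤ ENNReal.ofReal y := by
    intro y hy
    rcases le_total y 1 with h | h
    · exact hU y ⟨hy, h⟩
    · exact prob_le_one.trans (ENNReal.one_le_ofReal.2 h)
  have hfin : P {ω | U ω ≤ Y ω} ≤ ENNReal.ofReal a := by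
    have e : P {ω | U ω ≤ Y ω} = (P.map fun ω => (Y ω, U ω)) {p : ℝ × ℝ | p.2 ≤ p.1} := by
      rw [Measure.map_apply (hYm.prodMk hUmeas) hS]; rfl
    rw [e, hmap, Measure.prod_apply hS, lintegral_map (measurable_measure_prodMk_left hS) hYm]
    calc _ ≤ ∫⁻ ω, L ω * ENNReal.ofReal a ∂P := by
            refine lintegral_mono fun ω => ?_
            rw [Measure.map_apply hUmeas (measurable_prodMk_left hS)]
            refine (hU' (Y ω) (by positivity)).trans ?_
            change ENNReal.ofReal ((L ω).toReal * a) ≤ _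
            rw [ENNReal.ofReal_mul ENNReal.toReal_nonneg]
            gcongr
            exact ENNReal.ofReal_toReal_le
      _ = (∫⁻ ω, L ω ∂P) * ENNReal.ofReal a := lintegral_mul_const _ hLm
      _ ≤ 1 * ENNReal.ofReal a := by gcongr
      _ = _ := one_mul _
  refine (measure_mono_ae ?_).trans hfin
  filter_upwards [hLeq] with ω hω h
  change U ω ≤ (L ω).toReal * a
  rw [hω]
  exact (div_le_iff₀ ha).1 h
end

section
/- Let M = (M_t)_{t≥0} be a nonnegative supermartingale with respect to a filtration F = (F_t)_{t≥0} with E[M_0] ≤ 1, let τ be any F-stopping time, and let U be a random variable independent of F that is uniformly distributed on [0,1] or stochastically larger than uniform on [0,1]. Then for any a > 0, P( (∃ t < τ : M_t ≥ 1/a) or M_τ ≥ U/a ) ≤ a. -/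
open MeasureTheory ProbabilityTheory Filter
open scoped ENNReal

/-- The set `{σ > n}` where `σ = min τ (first time M ≥ 1/a)`. -/
def rvS {Ω : Type*} (M : ℕ → Ω → ℝ) (τ : Ω → ℕ∞) (a : ℝ) (n : ℕ) : Set Ω :=
  {ω | (n : ℕ∞) < τ ω ∧ ∀ k ≤ n, M k ω < 1 / a}

open Classical in
/-- The stopped process. -/
noncomputable def rvX {Ω : Type*} (M : ℕ → Ω → ℝ) (τ : Ω → ℕ∞) (a : ℝ) : ℕ → Ω → ℝ
  | 0 => M 0
  | n + 1 => (rvS M τ a n).piecewise (M (n + 1)) (rvX M τ a n)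

theorem rvS_anti {Ω : Type*} (M : ℕ → Ω → ℝ) (τ : Ω → ℕ∞) (a : ℝ) {m n : ℕ} (h : m ≤ n)
    {ω : Ω} (hω : ω ∈ rvS M τ a n) : ω ∈ rvS M τ a m :=
  ⟨lt_of_le_of_lt (by exact_mod_cast h) hω.1, fun k hk => hω.2 k (hk.trans h)⟩

theorem rvX_succ_mem {Ω : Type*} (M : ℕ → Ω → ℝ) (τ : Ω → ℕ∞) (a : ℝ) {n : ℕ}
    {ω : Ω} (hω : ω ∈ rvS M τ a n) : rvX M τ a (n + 1) ω = M (n + 1) ω := by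
  simp [rvX, hω]

theorem rvX_succ_notMem {Ω : Type*} (M : ℕ → Ω → ℝ) (τ : Ω → ℕ∞) (a : ℝ) {n : ℕ}
    {ω : Ω} (hω : ω ∉ rvS M τ a n) : rvX M τ a (n + 1) ω = rvX M τ a n ω := by
  simp [rvX, hω]

theorem rvX_eq_of_mem {Ω : Type*} (M : ℕ → Ω → ℝ) (τ : Ω → ℕ∞) (a : ℝ) {n : ℕ}
    {ω : Ω} (hω : ∀ m < n, ω ∈ rvS M τ a m) : rvX M τ a n ω = M n ω := by
  cases n with
  | zero => rfl
  | succ n => exact rvX_succ_mem M τ a (hω n (Nat.lt_succ_self n))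

theorem rvX_const {Ω : Type*} (M : ℕ → Ω → ℝ) (τ : Ω → ℕ∞) (a : ℝ) {n : ℕ}
    {ω : Ω} (hω : ω ∉ rvS M τ a n) (k : ℕ) (hk : n ≤ k) :
    rvX M τ a k ω = rvX M τ a n ω := by
  induction k, hk using Nat.le_induction with
  | base => rfl
  | succ k hk ih =>
    rw [rvX_succ_notMem M τ a (fun h => hω (rvS_anti M τ a hk h)), ih]

theorem rvX_nonneg {Ω : Type*} (M : ℕ → Ω → ℝ) (τ : Ω → ℕ∞) (a : ℝ)
    (hnn : ∀ t ω, 0 ≤ M t ω) (n : ℕ) (ω : Ω) : 0 ≤ rvX M τ a n ω := by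
  induction n with
  | zero => exact hnn 0 ω
  | succ n ih =>
    by_cases h : ω ∈ rvS M τ a n
    · rw [rvX_succ_mem M τ a h]; exact hnn _ _
    · rw [rvX_succ_notMem M τ a h]; exact ih

section
variable {Ω : Type*} [m0 : MeasurableSpace Ω] (P : Measure Ω) [IsProbabilityMeasure P]
    (F : Filtration ℕ m0) (M : ℕ → Ω → ℝ) (τ : Ω → ℕ∞) (a : ℝ)

theorem rvM_meas (hsuper : Supermartingale M F P) {k n : ℕ} (h : k ≤ n) :
    Measurable[F n] (M k) :=
  ((hsuper.1 k).measurable).mono (F.mono h) le_rfl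

theorem rvS_meas (hsuper : Supermartingale M F P)
    (hτ : ∀ t : ℕ, MeasurableSet[F t] {ω | τ ω ≤ (t : ℕ∞)}) (n : ℕ) :
    MeasurableSet[F n] (rvS M τ a n) := by
  have h1 : rvS M τ a n = {ω | τ ω ≤ (n : ℕ∞)}ᶜ ∩ ⋂ k : ℕ, ⋂ (_ : k ≤ n), {ω | M k ω < 1 / a} := by
    ext ω
    simp [rvS]
  rw [h1]
  refine MeasurableSet.inter (hτ n).compl ?_
  refine MeasurableSet.iInter fun k => MeasurableSet.iInter fun hk => ?_
  exact (rvM_meas P F M hsuper hk) measurableSet_Iio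

theorem rvX_meas (hsuper : Supermartingale M F P)
    (hτ : ∀ t : ℕ, MeasurableSet[F t] {ω | τ ω ≤ (t : ℕ∞)}) (n : ℕ) :
    Measurable[F n] (rvX M τ a n) := by
  induction n with
  | zero => exact rvM_meas P F M hsuper le_rfl
  | succ n ih =>
    refine Measurable.piecewise (m := F (n+1))
      (F.mono (Nat.le_succ n) _ (rvS_meas P F M τ a hsuper hτ n)) ?_ ?_
    · exact rvM_meas P F M hsuper le_rfl
    · exact ih.mono (F.mono (Nat.le_succ n)) le_rfl

theorem rvX_int (hsuper : Supermartingale M F P)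
    (hτ : ∀ t : ℕ, MeasurableSet[F t] {ω | τ ω ≤ (t : ℕ∞)}) (n : ℕ) :
    Integrable (rvX M τ a n) P ∧ ∫ ω, rvX M τ a n ω ∂P ≤ ∫ ω, M 0 ω ∂P := by
  induction n with
  | zero => exact ⟨hsuper.2.2 0, le_rfl⟩
  | succ n ih =>
    have hS' := rvS_meas P F M τ a hsuper hτ n
    have hS : MeasurableSet (rvS M τ a n) := F.le n _ hS'
    have hi : Integrable (rvX M τ a (n + 1)) P :=
      by
      classical
      simp only [rvX]
      exact Integrable.piecewise hS (hsuper.2.2 (n + 1)).integrableOn ih.1.integrableOn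
    refine ⟨hi, le_trans ?_ ih.2⟩
    rw [← integral_add_compl hS hi, ← integral_add_compl hS ih.1]
    have e1 : ∫ ω in rvS M τ a n, rvX M τ a (n + 1) ω ∂P
        = ∫ ω in rvS M τ a n, M (n + 1) ω ∂P :=
      setIntegral_congr_fun hS fun ω h => rvX_succ_mem M τ a h
    have e2 : ∫ ω in (rvS M τ a n)ᶜ, rvX M τ a (n + 1) ω ∂P
        = ∫ ω in (rvS M τ a n)ᶜ, rvX M τ a n ω ∂P :=
      setIntegral_congr_fun hS.compl fun ω h => rvX_succ_notMem M τ a h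
    have e3 : ∫ ω in rvS M τ a n, rvX M τ a n ω ∂P
        = ∫ ω in rvS M τ a n, M n ω ∂P :=
      setIntegral_congr_fun hS fun ω h =>
        rvX_eq_of_mem M τ a fun m hm => rvS_anti M τ a hm.le h
    have e4 := hsuper.setIntegral_le (Nat.le_succ n) hS'
    rw [e1, e2, e3]
    simp only [Nat.succ_eq_add_one] at e4
    linarith

end

theorem rv_key {Ω : Type*} (M : ℕ → Ω → ℝ) (τ : Ω → ℕ∞) (a : ℝ) (ha : 0 < a)
    (Mlim U : Ω → ℝ) (ω : Ω)
    (hlim : Tendsto (fun t => M t ω) atTop (nhds (Mlim ω)))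
    (hω : (∃ t : ℕ, (t : ℕ∞) < τ ω ∧ M t ω ≥ 1 / a)
        ∨ (if τ ω = ⊤ then Mlim ω else M ((τ ω).toNat) ω) ≥ U ω / a) :
    ENNReal.ofReal (min (U ω) 1)
      ≤ ENNReal.ofReal a * liminf (fun n => ENNReal.ofReal (rvX M τ a n ω)) atTop := by
  suffices h : ∃ y, Tendsto (fun n => rvX M τ a n ω) atTop (nhds y) ∧ min (U ω) 1 ≤ a * y by
    obtain ⟨y, hy, hle⟩ := h
    rw [(ENNReal.tendsto_ofReal hy).liminf_eq, ← ENNReal.ofReal_mul ha.le]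
    exact ENNReal.ofReal_le_ofReal hle
  by_cases hall : ∀ n, ω ∈ rvS M τ a n
  · refine ⟨Mlim ω, ?_, ?_⟩
    · refine hlim.congr fun n => ?_
      exact (rvX_eq_of_mem M τ a fun m _ => hall m).symm
    · have htop : τ ω = ⊤ := by
        rw [ENat.eq_top_iff_forall_gt]
        exact fun n => (hall n).1
      rcases hω with ⟨t, _, ht⟩ | h
      · exact absurd ((hall t).2 t le_rfl) (not_lt.mpr ht)
      · rw [if_pos htop, ge_iff_le, div_le_iff₀ ha] at h
        exact (min_le_left _ _).trans (by linarith)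
  · push Not at hall
    classical
    let n := Nat.find hall
    have hn : ω ∉ rvS M τ a n := Nat.find_spec hall
    have hmin : ∀ m < n, ω ∈ rvS M τ a m := fun m hm => by
      have := Nat.find_min hall hm
      simpa using this
    refine ⟨M n ω, ?_, ?_⟩
    · refine tendsto_const_nhds.congr' ?_
      filter_upwards [eventually_ge_atTop n] with k hk
      rw [rvX_const M τ a hn k hk, rvX_eq_of_mem M τ a hmin]
    · by_cases hc : 1 / a ≤ M n ω
      · rw [div_le_iff₀ ha] at hc
        exact (min_le_right _ _).trans (by linarith)
      · have hcr : ∀ k ≤ n, M k ω < 1 / a := fun k hk => by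
          rcases hk.lt_or_eq with h | h
          · exact (hmin k h).2 k le_rfl
          · rw [h]; exact not_le.mp hc
        have h1 : τ ω ≤ n := by
          by_contra h
          exact hn ⟨not_le.mp h, hcr⟩
        have h2 : τ ω = n := by
          refine le_antisymm h1 ?_
          by_contra h
          rw [not_le] at h
          obtain ⟨m, hm⟩ := ENat.ne_top_iff_exists.mp h.ne_top
          rw [← hm] at h
          have h3 : m < n := by exact_mod_cast h
          have := (hmin m h3).1
          rw [← hm] at this
          exact lt_irrefl _ this
        rcases hω with ⟨t, h3, ht⟩ | h
        · rw [h2] at h3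
          have h4 : t < n := by exact_mod_cast h3
          exact absurd (hcr t h4.le) (not_lt.mpr ht)
        · rw [h2, if_neg (ENat.natCast_ne_top n), ENat.toNat_natCast, ge_iff_le, div_le_iff₀ ha] at h
          exact (min_le_left _ _).trans (by linarith)

theorem randomized_ville_inequality_corollary
    {Ω : Type*} [m0 : MeasurableSpace Ω] (P : Measure Ω) [IsProbabilityMeasure P]
    (F : Filtration ℕ m0) (M : ℕ → Ω → ℝ)
    (hsuper : Supermartingale M F P)
    (hnn : ∀ t ω, 0 ≤ M t ω)
    (hM0 : ∫ ω, M 0 ω ∂P ≤ 1)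
    (τ : Ω → ℕ∞)
    (hτ : ∀ t : ℕ, MeasurableSet[F t] {ω | τ ω ≤ (t : ℕ∞)})
    (Mlim : Ω → ℝ)
    (hMlim : ∀ᵐ ω ∂P, Tendsto (fun t => M t ω) atTop (nhds (Mlim ω)))
    (U : Ω → ℝ) (hUmeas : Measurable U)
    (hindep : Indep (⨆ t, (F t : MeasurableSpace Ω))
      (MeasurableSpace.comap U inferInstance) P)
    (hU : ∀ u ∈ Set.Icc (0 : ℝ) 1, P {ω | U ω ≤ u} ≤ ENNReal.ofReal u)
    (a : ℝ) (ha : 0 < a) :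
    P {ω | (∃ t : ℕ, (t : ℕ∞) < τ ω ∧ M t ω ≥ 1 / a)
        ∨ (if τ ω = ⊤ then Mlim ω else M ((τ ω).toNat) ω) ≥ U ω / a}
      ≤ ENNReal.ofReal a := by
  let Y : Ω → ℝ≥0∞ := fun ω => liminf (fun n => ENNReal.ofReal (rvX M τ a n ω)) atTop
  let V : Ω → ℝ≥0∞ := fun ω => ENNReal.ofReal (min (U ω) 1)
  have hsup : (⨆ t, (F t : MeasurableSpace Ω)) ≤ m0 := iSup_le F.le
  have hXm : ∀ n, Measurable[⨆ t, (F t : MeasurableSpace Ω)]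
      (fun ω => ENNReal.ofReal (rvX M τ a n ω)) := fun n =>
    ENNReal.measurable_ofReal.comp
      ((rvX_meas P F M τ a hsuper hτ n).mono (le_iSup (fun t => F t) n) le_rfl)
  have hY' : Measurable[⨆ t, (F t : MeasurableSpace Ω)] Y :=
    Measurable.liminf (mδ := ⨆ t, (F t : MeasurableSpace Ω)) hXm
  have hY : Measurable Y := hY'.mono hsup le_rfl
  have hg : Measurable fun x : ℝ => ENNReal.ofReal (min x 1) :=
    ENNReal.measurable_ofReal.comp (measurable_id.min measurable_const)
  have hV : Measurable V := hg.comp hUmeas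
  have hYint : ∫⁻ ω, Y ω ∂P ≤ 1 := by
    refine (lintegral_liminf_le fun n => (hXm n).mono hsup le_rfl).trans ?_
    refine (liminf_le_liminf (v := fun _ => (1 : ℝ≥0∞)) (Eventually.of_forall fun n => ?_)).trans ?_
    · obtain ⟨h1, h2⟩ := rvX_int P F M τ a hsuper hτ n
      change ∫⁻ ω, ENNReal.ofReal (rvX M τ a n ω) ∂P ≤ 1
      rw [← ofReal_integral_eq_lintegral_ofReal h1
        (Eventually.of_forall (rvX_nonneg M τ a hnn n))]
      exact ENNReal.ofReal_le_one.mpr (h2.trans hM0)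
    · simp
  have hVc : ∀ c : ℝ≥0∞, P {ω | V ω ≤ c} ≤ c := fun c => by
    rcases le_or_gt 1 c with h | h
    · exact prob_le_one.trans h
    · have hc : c ≠ ⊤ := h.ne_top
      have h1 : c.toReal < 1 := by
        rw [← ENNReal.toReal_one]; exact (ENNReal.toReal_lt_toReal hc ENNReal.one_ne_top).mpr h
      have h2 := hU c.toReal ⟨ENNReal.toReal_nonneg, h1.le⟩
      rw [ENNReal.ofReal_toReal hc] at h2
      refine (measure_mono fun ω hω => ?_).trans h2
      have h3 : ENNReal.ofReal (min (U ω) 1) ≤ c := hω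
      rw [ENNReal.ofReal_le_iff_le_toReal hc] at h3
      rcases min_le_iff.mp h3 with h4 | h4
      · exact h4
      · exact absurd h4 (not_le.mpr h1)
  have hind : IndepFun Y V P := by
    rw [IndepFun_iff_Indep]
    refine indep_of_indep_of_le_right (indep_of_indep_of_le_left hindep hY'.comap_le) ?_
    have : V = (fun x : ℝ => ENNReal.ofReal (min x 1)) ∘ U := rfl
    rw [this, ← MeasurableSpace.comap_comp]
    exact MeasurableSpace.comap_mono hg.comap_le
  have hmap := (indepFun_iff_map_prod_eq_prod_map_map hY.aemeasurable hV.aemeasurable).mp hind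
  have hset : MeasurableSet {p : ℝ≥0∞ × ℝ≥0∞ | p.2 ≤ ENNReal.ofReal a * p.1} :=
    measurableSet_le measurable_snd (measurable_fst.const_mul _)
  calc _ ≤ P {ω | V ω ≤ ENNReal.ofReal a * Y ω} := by
        refine measure_mono_ae ?_
        filter_upwards [hMlim] with ω hlim hω
        exact rv_key M τ a ha Mlim U ω hlim hω
    _ = (P.map fun ω => (Y ω, V ω)) {p : ℝ≥0∞ × ℝ≥0∞ | p.2 ≤ ENNReal.ofReal a * p.1} := by
        rw [Measure.map_apply (hY.prodMk hV) hset]; rfl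
    _ = ∫⁻ y, (P.map V) {v | v ≤ ENNReal.ofReal a * y} ∂(P.map Y) := by
        have : IsProbabilityMeasure (P.map V) := Measure.isProbabilityMeasure_map hV.aemeasurable
        rw [hmap, Measure.prod_apply hset]; rfl
    _ ≤ ∫⁻ y, ENNReal.ofReal a * y ∂(P.map Y) := by
        refine lintegral_mono fun y => ?_
        change (P.map V) (Set.Iic (ENNReal.ofReal a * y)) ≤ _
        rw [Measure.map_apply hV measurableSet_Iic]
        exact hVc _
    _ = ENNReal.ofReal a * ∫⁻ ω, Y ω ∂P := by
        rw [lintegral_const_mul _ measurable_id', lintegral_map measurable_id' hY]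
    _ ≤ ENNReal.ofReal a := by
        calc _ ≤ ENNReal.ofReal a * 1 := by gcongr
          _ = _ := mul_one _
end

section
/- Let (X_t)_{t≥1} be a nonnegative reverse submartingale with respect to a reverse filtration (E_t)_{t≥1}, meaning each X_t is E_t-measurable and integrable and E[X_t | E_{t+1}] ≥ X_{t+1} for all t, where E_1 ⊇ E_2 ⊇ ⋯. Then for any a > 0, P( sup_{t ≥ 1} X_t ≥ 1/a ) ≤ a · E[X_1]. -/
open MeasureTheory ProbabilityTheory
open scoped ENNReal

theorem reverse_ville_aux
    {Ω : Type*} [m0 : MeasurableSpace Ω] (P : Measure Ω) [IsProbabilityMeasure P]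
    (E : ℕ → MeasurableSpace Ω)
    (hEle : ∀ t, E t ≤ m0)
    (hEanti : ∀ t, E (t + 1) ≤ E t)
    (X : ℕ → Ω → ℝ)
    (hadapted : ∀ t, StronglyMeasurable[E t] (X t))
    (hint : ∀ t, Integrable (X t) P)
    (hrsub : ∀ t, X (t + 1) ≤ᵐ[P] P[X t | E (t + 1)])
    (c : ℝ) (n : ℕ) : ∀ s : ℕ, ∃ D : Set Ω, MeasurableSet[E s] D ∧
      (∀ ω, ω ∈ D ↔ ∃ t ≤ n, c ≤ X (s + t) ω) ∧ c * P.real D ≤ ∫ ω in D, X s ω ∂P := by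
  have hm : ∀ s, MeasurableSet[E s] {ω | c ≤ X s ω} := fun s =>
    (hadapted s).measurable measurableSet_Ici
  induction n with
  | zero =>
    intro s
    refine ⟨{ω | c ≤ X s ω}, hm s, by simp, ?_⟩
    exact setIntegral_ge_of_const_le_real (hEle s _ (hm s)) (measure_ne_top _ _)
      (fun x hx => hx) (hint s).integrableOn
  | succ n ih =>
    intro s
    obtain ⟨D, hD, hmem, hle⟩ := ih (s + 1)
    have hDs : MeasurableSet[E s] D := hEanti s _ hD
    have hF : MeasurableSet[E s] ({ω | c ≤ X s ω} \ D) := (hm s).diff hDs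
    have hdisj : Disjoint D ({ω | c ≤ X s ω} \ D) := Set.disjoint_sdiff_right
    refine ⟨D ∪ ({ω | c ≤ X s ω} \ D), hDs.union hF, ?_, ?_⟩
    · intro ω
      rw [Set.union_diff_self, Set.mem_union, hmem]
      constructor
      · rintro (⟨t, ht, h⟩ | h)
        · exact ⟨t + 1, by omega, by rwa [show s + (t + 1) = s + 1 + t by omega]⟩
        · exact ⟨0, by omega, h⟩
      · rintro ⟨t, ht, h⟩
        cases t with
        | zero => exact Or.inr h
        | succ t => exact Or.inl ⟨t, by omega, by rwa [show s + 1 + t = s + (t + 1) by omega]⟩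
    · rw [measureReal_union hdisj (hEle s _ hF),
        setIntegral_union hdisj (hEle s _ hF) (hint s).integrableOn (hint s).integrableOn, mul_add]
      have h1 : ∫ ω in D, X (s + 1) ω ∂P ≤ ∫ ω in D, X s ω ∂P := by
        rw [← setIntegral_condExp (hEle (s + 1)) (hint s) hD]
        exact setIntegral_mono_ae (hint _).integrableOn integrable_condExp.integrableOn (hrsub s)
      have h2 : c * P.real ({ω | c ≤ X s ω} \ D) ≤ ∫ ω in {ω | c ≤ X s ω} \ D, X s ω ∂P :=
        setIntegral_ge_of_const_le_real (hEle s _ hF) (measure_ne_top _ _)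
          (fun x hx => hx.1) (hint s).integrableOn
      linarith

/-- **Time-reversed Ville inequality.** Let `(X t)` be a nonnegative reverse
submartingale with respect to a reverse filtration `(E t)` (a decreasing family
of sub-σ-algebras), i.e. each `X t` is `E t`-measurable and integrable and
`E[X t | E (t+1)] ≥ X (t+1)` for all `t`. Then for any `a > 0`,
`P( sup_t X t ≥ 1/a ) ≤ a · E[X 0]`. (Indices start at `0`, so `X 0` plays the
role of `X₁`.) -/
theorem time_reversed_ville_inequality
    {Ω : Type*} [m0 : MeasurableSpace Ω] (P : Measure Ω) [IsProbabilityMeasure P]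
    (E : ℕ → MeasurableSpace Ω)
    (hEle : ∀ t, E t ≤ m0)
    (hEanti : ∀ t, E (t + 1) ≤ E t)
    (X : ℕ → Ω → ℝ)
    (hadapted : ∀ t, StronglyMeasurable[E t] (X t))
    (hint : ∀ t, Integrable (X t) P)
    (hnn : ∀ t ω, 0 ≤ X t ω)
    (hrsub : ∀ t, X (t + 1) ≤ᵐ[P] P[X t | E (t + 1)])
    (a : ℝ) (ha : 0 < a) :
    P {ω | ∃ t : ℕ, X t ω ≥ 1 / a} ≤ ENNReal.ofReal (a * ∫ ω, X 0 ω ∂P) := by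
  have hset : {ω | ∃ t : ℕ, X t ω ≥ 1 / a} = ⋃ n : ℕ, {ω | ∃ t ≤ n, 1 / a ≤ X t ω} := by
    ext ω
    simp only [Set.mem_setOf_eq, Set.mem_iUnion]
    exact ⟨fun ⟨t, h⟩ => ⟨t, t, le_rfl, h⟩, fun ⟨_, t, _, h⟩ => ⟨t, h⟩⟩
  have hmono : Monotone fun n : ℕ => {ω | ∃ t ≤ n, 1 / a ≤ X t ω} :=
    fun i j hij ω ⟨t, ht, h⟩ => ⟨t, ht.trans hij, h⟩
  rw [hset, hmono.measure_iUnion]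
  refine iSup_le fun n => ?_
  obtain ⟨D, hD, hmem, hle⟩ :=
    reverse_ville_aux P E hEle hEanti X hadapted hint hrsub (1 / a) n 0
  have hDeq : {ω | ∃ t ≤ n, 1 / a ≤ X t ω} = D := by
    ext ω
    rw [hmem]
    simp
  rw [hDeq, ← ofReal_measureReal]
  apply ENNReal.ofReal_le_ofReal
  have h3 : ∫ ω in D, X 0 ω ∂P ≤ ∫ ω, X 0 ω ∂P :=
    setIntegral_le_integral (hint 0) (Filter.Eventually.of_forall (hnn 0))
  have h4 := mul_le_mul_of_nonneg_left (hle.trans h3) ha.le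
  rwa [← mul_assoc, mul_one_div_cancel ha.ne', one_mul] at h4
end

section
/- Let (X_t)_{t≥1} be a nonnegative reverse submartingale with respect to a reverse filtration (E_t)_{t≥1}, let τ be a reverse stopping time with respect to (E_t) (i.e., {τ = t} ∈ E_t for all t ≥ 1), and let U be uniformly distributed on [0,1] and independent of (E_t). Then for any a > 0, P( X_τ ≥ U/a ) ≤ a · E[X_1]. -/
open MeasureTheory ProbabilityTheory
open scoped ENNReal

/-- **Uniformly-randomized time-reversed Ville inequality.** Let `(X t)` be a
nonnegative reverse submartingale with respect to a reverse filtration `(E t)`,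
let `τ` be a reverse stopping time (`{τ = t} ∈ E t` for all `t`), and let `U` be
uniform on `[0,1]` and independent of the reverse filtration (equivalently, of
`E 0`, the largest σ-algebra of the decreasing family). Then for any `a > 0`,
`P( X_τ ≥ U/a ) ≤ a · E[X 0]`. -/
theorem uniformly_randomized_time_reversed_ville_inequality
    {Ω : Type*} [m0 : MeasurableSpace Ω] (P : Measure Ω) [IsProbabilityMeasure P]
    (E : ℕ → MeasurableSpace Ω)
    (hEle : ∀ t, E t ≤ m0)
    (hEanti : ∀ t, E (t + 1) ≤ E t)
    (X : ℕ → Ω → ℝ)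
    (hadapted : ∀ t, StronglyMeasurable[E t] (X t))
    (hint : ∀ t, Integrable (X t) P)
    (hnn : ∀ t ω, 0 ≤ X t ω)
    (hrsub : ∀ t, X (t + 1) ≤ᵐ[P] P[X t | E (t + 1)])
    (τ : Ω → ℕ)
    (hτ : ∀ t : ℕ, MeasurableSet[E t] {ω | τ ω = t})
    (U : Ω → ℝ) (hUmeas : Measurable U)
    (hindep : Indep (E 0) (MeasurableSpace.comap U inferInstance) P)
    (hU : ∀ u ∈ Set.Icc (0 : ℝ) 1, P {ω | U ω ≤ u} = ENNReal.ofReal u)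
    (a : ℝ) (ha : 0 < a) :
    P {ω | X (τ ω) ω ≥ U ω / a} ≤ ENNReal.ofReal (a * ∫ ω, X 0 ω ∂P) := by
  have hE0 : ∀ t, E t ≤ E 0 := fun t => antitone_nat_of_succ_le hEanti (Nat.zero_le t)
  have key : ∀ t, ∀ A, MeasurableSet[E t] A → ∫ ω in A, X t ω ∂P ≤ ∫ ω in A, X 0 ω ∂P := by
    intro t
    induction t with
    | zero => intro A _; exact le_rfl
    | succ t ih =>
      intro A hA
      calc ∫ ω in A, X (t + 1) ω ∂P ≤ ∫ ω in A, (P[X t | E (t + 1)]) ω ∂P :=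
            setIntegral_mono_ae (hint _).integrableOn integrable_condExp.integrableOn (hrsub t)
        _ = ∫ ω in A, X t ω ∂P := setIntegral_condExp (hEle _) (hint t) hA
        _ ≤ _ := ih A (hEanti t A hA)
  have hYm : Measurable[E 0] (fun ω => X (τ ω) ω) := by
    intro B hB
    have : (fun ω => X (τ ω) ω) ⁻¹' B = ⋃ t, ({ω | τ ω = t} ∩ X t ⁻¹' B) := by
      ext ω; simp
    rw [this]
    exact MeasurableSet.iUnion fun t => hE0 t _
      (MeasurableSet.inter (hτ t) ((hadapted t).measurable hB))
  have hYm0 : Measurable (fun ω => X (τ ω) ω) := fun B hB => hEle 0 _ (hYm hB)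
  have hind : IndepFun (fun ω => X (τ ω) ω) U P :=
    (IndepFun_iff_Indep _ _ _).2 (indep_of_indep_of_le_left hindep hYm.comap_le)
  have hprod := (indepFun_iff_map_prod_eq_prod_map_map hYm0.aemeasurable hUmeas.aemeasurable).1 hind
  have hSm : MeasurableSet {p : ℝ × ℝ | p.2 ≤ a * p.1} :=
    measurableSet_le measurable_snd (measurable_fst.const_mul a)
  have hUb : ∀ y : ℝ, 0 ≤ y → P {ω | U ω ≤ y} ≤ ENNReal.ofReal y := by
    intro y hy
    rcases le_total y 1 with h | h
    · exact (hU y ⟨hy, h⟩).le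
    · exact prob_le_one.trans (by simpa using h)
  have h1 : P {ω | X (τ ω) ω ≥ U ω / a} ≤ ∫⁻ ω, ENNReal.ofReal (a * X (τ ω) ω) ∂P := by
    have hset : {ω | X (τ ω) ω ≥ U ω / a} =
        (fun ω => (X (τ ω) ω, U ω)) ⁻¹' {p : ℝ × ℝ | p.2 ≤ a * p.1} := by
      ext ω
      simp only [ge_iff_le, Set.mem_setOf_eq, Set.mem_preimage]
      rw [div_le_iff₀ ha, mul_comm]
    have : IsProbabilityMeasure (P.map U) := Measure.isProbabilityMeasure_map hUmeas.aemeasurable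
    rw [hset, ← Measure.map_apply (hYm0.prodMk hUmeas) hSm, hprod, Measure.prod_apply hSm,
      lintegral_map (measurable_measure_prodMk_left hSm) hYm0]
    refine lintegral_mono fun ω => ?_
    rw [Measure.map_apply hUmeas (measurable_prodMk_left hSm)]
    exact hUb (a * X (τ ω) ω) (mul_nonneg ha.le (hnn _ _))
  refine h1.trans ?_
  have hτm : ∀ t, MeasurableSet {ω | τ ω = t} := fun t => hEle t _ (hτ t)
  have hun : (⋃ t, {ω | τ ω = t}) = Set.univ := by ext ω; simp
  have hdisj : Pairwise (Function.onFun Disjoint fun t => {ω | τ ω = t}) := by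
    intro s t hst
    refine Set.disjoint_left.2 fun ω h1 h2 => hst ?_
    exact (h1 : τ ω = s).symm.trans h2
  have hsplit : ∀ f : Ω → ℝ≥0∞, ∫⁻ ω, f ω ∂P = ∑' t, ∫⁻ ω in {ω | τ ω = t}, f ω ∂P := by
    intro f
    rw [← lintegral_iUnion hτm hdisj, hun, Measure.restrict_univ]
  rw [← integral_const_mul, ofReal_integral_eq_lintegral_ofReal ((hint 0).const_mul a)
    (Filter.Eventually.of_forall fun ω => mul_nonneg ha.le (hnn 0 ω)), hsplit, hsplit]
  refine ENNReal.tsum_le_tsum fun t => ?_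
  have e1 : ∫⁻ ω in {ω | τ ω = t}, ENNReal.ofReal (a * X (τ ω) ω) ∂P
      = ∫⁻ ω in {ω | τ ω = t}, ENNReal.ofReal (a * X t ω) ∂P := by
    refine setLIntegral_congr_fun (hτm t) fun ω hω => ?_
    have : τ ω = t := hω
    simp only [this]
  have e2 : ∀ s, ∫⁻ ω in {ω | τ ω = t}, ENNReal.ofReal (a * X s ω) ∂P
      = ENNReal.ofReal (a * ∫ ω in {ω | τ ω = t}, X s ω ∂P) := by
    intro s
    rw [← integral_const_mul, ofReal_integral_eq_lintegral_ofReal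
      ((hint s).const_mul a).integrableOn
      (Filter.Eventually.of_forall fun ω => mul_nonneg ha.le (hnn s ω))]
  rw [e1, e2, e2]
  exact ENNReal.ofReal_le_ofReal (mul_le_mul_of_nonneg_left (key t _ (hτ t)) ha.le)
end

section
/- Let X_1,…,X_n be exchangeable integrable real-valued random variables, and let U be uniformly distributed on [0,1], independent of (X_1,…,X_n). Then for any a ∈ (0,1), P( X_1 ≥ U/a or ∃ t ∈ {1,…,n} : |(1/t) ∑_{i=1}^t X_i| ≥ 1/a ) ≤ a · E[|X_1|]. -/
open MeasureTheory ProbabilityTheory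
open scoped ENNReal BigOperators

/-- scaled partial sums -/
noncomputable def eumiS (n : ℕ) (a : ℝ) (t : ℕ) (x : Fin n → ℝ) : ℝ≥0∞ :=
  ∑ i ∈ Finset.univ.filter (fun i : Fin n => (i : ℕ) < t), ENNReal.ofReal (a * |x i|)

lemma eumiS_meas (n : ℕ) (a : ℝ) (t : ℕ) : Measurable (eumiS n a t) := by
  unfold eumiS
  fun_prop

lemma eumiS_swap (n : ℕ) (a : ℝ) (t : ℕ) (x : Fin n → ℝ) (i j : Fin n)
    (hi : (i : ℕ) < t) (hj : (j : ℕ) < t) :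
    eumiS n a t (fun k => x (Equiv.swap i j k)) = eumiS n a t x := by
  unfold eumiS
  refine Finset.sum_equiv (Equiv.swap i j) ?_ ?_
  · intro k
    simp only [Finset.mem_filter, Finset.mem_univ, true_and]
    rcases eq_or_ne k i with rfl | h1
    · simp [hi, hj]
    rcases eq_or_ne k j with rfl | h2
    · simp [hi, hj]
    rw [Equiv.swap_apply_of_ne_of_ne h1 h2]
  · intro k _
    rfl

/-- last crossing at time `t` -/
def eumiC (n : ℕ) (a : ℝ) (t : ℕ) : Set (Fin n → ℝ) :=
  {x | (t : ℝ≥0∞) ≤ eumiS n a t x} ∩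
    ⋂ s ∈ Finset.Ioc t n, {x | (s : ℝ≥0∞) ≤ eumiS n a s x}ᶜ

lemma eumiC_meas (n : ℕ) (a : ℝ) (t : ℕ) : MeasurableSet (eumiC n a t) := by
  unfold eumiC
  refine (measurableSet_le measurable_const (eumiS_meas n a t)).inter ?_
  refine Finset.measurableSet_biInter _ fun s _ => ?_
  exact (measurableSet_le measurable_const (eumiS_meas n a s)).compl

lemma eumiC_swap (n : ℕ) (a : ℝ) (t : ℕ) (i j : Fin n)
    (hi : (i : ℕ) < t) (hj : (j : ℕ) < t) :
    (fun (x : Fin n → ℝ) k => x (Equiv.swap i j k)) ⁻¹' eumiC n a t = eumiC n a t := by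
  ext x
  simp only [eumiC, Set.mem_preimage, Set.mem_inter_iff, Set.mem_ofPred_eq, Set.mem_iInter,
    Set.mem_compl_iff, Finset.mem_Ioc]
  rw [eumiS_swap n a t x i j hi hj]
  refine and_congr Iff.rfl (forall_congr' fun s => forall_congr' fun hs => ?_)
  rw [eumiS_swap n a s x i j (hi.trans hs.1) (hj.trans hs.1)]

lemma eumiC_le (n : ℕ) (hn : 0 < n) (a : ℝ) (μ : Measure (Fin n → ℝ))
    (hμ : ∀ π : Equiv.Perm (Fin n), μ.map (fun x i => x (π i)) = μ)
    (t : ℕ) (ht : 1 ≤ t) (htn : t ≤ n) :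
    μ (eumiC n a t) ≤ ∫⁻ x in eumiC n a t, ENNReal.ofReal (a * |x ⟨0, hn⟩|) ∂μ := by
  have key : ∀ i : Fin n, (i : ℕ) < t →
      ∫⁻ x in eumiC n a t, ENNReal.ofReal (a * |x i|) ∂μ
        = ∫⁻ x in eumiC n a t, ENNReal.ofReal (a * |x ⟨0, hn⟩|) ∂μ := by
    intro i hi
    have hm : Measurable (fun (x : Fin n → ℝ) k => x (Equiv.swap ⟨0, hn⟩ i k)) := by fun_prop
    have mp : MeasurePreserving (fun (x : Fin n → ℝ) k => x (Equiv.swap ⟨0, hn⟩ i k)) μ μ :=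
      ⟨hm, hμ _⟩
    have := mp.setLIntegral_comp_preimage (eumiC_meas n a t)
      (f := fun x : Fin n → ℝ => ENNReal.ofReal (a * |x ⟨0, hn⟩|)) (by fun_prop)
    rw [eumiC_swap n a t ⟨0, hn⟩ i ht hi] at this
    rw [← this]
    simp
  have hcard : (Finset.univ.filter (fun i : Fin n => (i : ℕ) < t)).card = t := by
    simp [Fin.card_filter_val_lt, htn]
  have hsum : ∫⁻ x in eumiC n a t, eumiS n a t x ∂μ
      = t * ∫⁻ x in eumiC n a t, ENNReal.ofReal (a * |x ⟨0, hn⟩|) ∂μ := by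
    unfold eumiS
    rw [lintegral_finsetSum _ (fun i _ => by fun_prop)]
    rw [Finset.sum_congr rfl (fun i hi => key i (Finset.mem_filter.1 hi).2)]
    rw [Finset.sum_const, hcard, nsmul_eq_mul]
  have hle : (t : ℝ≥0∞) * μ (eumiC n a t) ≤ ∫⁻ x in eumiC n a t, eumiS n a t x ∂μ := by
    rw [← setLIntegral_const]
    exact setLIntegral_mono (eumiS_meas n a t) fun x hx => hx.1
  rw [hsum] at hle
  refine (ENNReal.mul_le_mul_iff_right ?_ (ENNReal.natCast_ne_top t)).1 hle
  exact_mod_cast (by omega : t ≠ 0)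

/-- some crossing -/
def eumiB (n : ℕ) (a : ℝ) : Set (Fin n → ℝ) := ⋃ t ∈ Finset.Icc 1 n, eumiC n a t

lemma eumiB_meas (n : ℕ) (a : ℝ) : MeasurableSet (eumiB n a) :=
  Finset.measurableSet_biUnion _ fun t _ => eumiC_meas n a t

lemma eumiB_mem (n : ℕ) (a : ℝ) (x : Fin n → ℝ) (t : ℕ) (ht : 1 ≤ t) (htn : t ≤ n)
    (h : (t : ℝ≥0∞) ≤ eumiS n a t x) : x ∈ eumiB n a := by
  classical
  let F : Finset ℕ := (Finset.Icc 1 n).filter (fun s : ℕ => (s : ℝ≥0∞) ≤ eumiS n a s x)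
  have hF : F.Nonempty := ⟨t, by simp [F, ht, htn, h]⟩
  obtain ⟨m, hm, hmax⟩ := F.exists_max_image id hF
  simp only [F, Finset.mem_filter, Finset.mem_Icc, id] at hm hmax
  simp only [eumiB, eumiC, Set.mem_iUnion, Set.mem_inter_iff, Set.mem_ofPred_eq, Set.mem_iInter,
    Set.mem_compl_iff, Finset.mem_Ioc, Finset.mem_Icc]
  refine ⟨m, hm.1, hm.2, fun s hs hh => ?_⟩
  have := hmax s ⟨⟨by omega, hs.2⟩, hh⟩
  omega

lemma eumiB_le (n : ℕ) (hn : 0 < n) (a : ℝ) (μ : Measure (Fin n → ℝ))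
    (hμ : ∀ π : Equiv.Perm (Fin n), μ.map (fun x i => x (π i)) = μ) :
    μ (eumiB n a) ≤ ∫⁻ x in eumiB n a, ENNReal.ofReal (a * |x ⟨0, hn⟩|) ∂μ := by
  have hlt : ∀ s t : ℕ, s < t → t ≤ n → Disjoint (eumiC n a s) (eumiC n a t) := by
    intro s t hst htn
    rw [Set.disjoint_left]
    intro x hs ht
    have := Set.mem_iInter₂.1 hs.2 t (Finset.mem_Ioc.2 ⟨hst, htn⟩)
    exact this ht.1
  have hd : Set.PairwiseDisjoint (↑(Finset.Icc 1 n)) (eumiC n a) := by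
    intro s hs t ht hst
    simp only [Finset.coe_Icc, Set.mem_Icc] at hs ht
    rcases lt_or_gt_of_ne hst with h | h
    · exact hlt s t h ht.2
    · exact (hlt t s h hs.2).symm
  unfold eumiB
  rw [lintegral_biUnion_finset hd (fun t _ => eumiC_meas n a t)]
  refine (measure_biUnion_finset_le _ _).trans (Finset.sum_le_sum fun t ht => ?_)
  rw [Finset.mem_Icc] at ht
  exact eumiC_le n hn a μ hμ t ht.1 ht.2

/-- **Exchangeable and uniformly-randomized Markov inequality (EUMI).** Let
`X 0, …, X (n-1)` be exchangeable integrable random variables and let `U` be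
uniform on `[0,1]`, independent of `(X 0, …, X (n-1))`. Then for any
`a ∈ (0,1)`,
`P( X 0 ≥ U/a or ∃ 1 ≤ t ≤ n, |(1/t) ∑_{i<t} X i| ≥ 1/a ) ≤ a · E[|X 0|]`. -/
theorem exchangeable_uniformly_randomized_markov_inequality
    {Ω : Type*} [MeasurableSpace Ω] (P : Measure Ω) [IsProbabilityMeasure P]
    (n : ℕ) (hn : 0 < n)
    (X : Fin n → Ω → ℝ)
    (hmeas : ∀ i, Measurable (X i))
    (hint : ∀ i, Integrable (X i) P)
    (hexch : ∀ π : Equiv.Perm (Fin n),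
      Measure.map (fun ω => fun i => X (π i) ω) P
        = Measure.map (fun ω => fun i => X i ω) P)
    (U : Ω → ℝ) (hUmeas : Measurable U)
    (hU : ∀ u ∈ Set.Icc (0 : ℝ) 1, P {ω | U ω ≤ u} = ENNReal.ofReal u)
    (hindep : IndepFun (fun ω => fun i => X i ω) U P)
    (a : ℝ) (ha : 0 < a) (ha1 : a < 1) :
    P {ω | X ⟨0, hn⟩ ω ≥ U ω / a ∨
        ∃ t : ℕ, 1 ≤ t ∧ t ≤ n ∧
          |(t : ℝ)⁻¹ * ∑ i ∈ Finset.univ.filter (fun i : Fin n => (i : ℕ) < t), X i ω|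
            ≥ 1 / a}
      ≤ ENNReal.ofReal (a * ∫ ω, |X ⟨0, hn⟩ ω| ∂P) := by
  have hXm : Measurable (fun ω => fun i => X i ω) := measurable_pi_lambda _ hmeas
  set μ := Measure.map (fun ω => fun i => X i ω) P with hμdef
  set ν := Measure.map U P with hνdef
  have : IsProbabilityMeasure μ := Measure.isProbabilityMeasure_map hXm.aemeasurable
  have : IsProbabilityMeasure ν := Measure.isProbabilityMeasure_map hUmeas.aemeasurable
  have hinv : ∀ π : Equiv.Perm (Fin n), μ.map (fun x i => x (π i)) = μ := by
    intro π
    refine Eq.trans ?_ (hexch π)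
    rw [hμdef, Measure.map_map (by fun_prop) hXm]
    rfl
  have hprod : P.map (fun ω => ((fun i => X i ω), U ω)) = μ.prod ν :=
    (indepFun_iff_map_prod_eq_prod_map_map hXm.aemeasurable hUmeas.aemeasurable).1 hindep
  let E : Set ((Fin n → ℝ) × ℝ) := {p | p.1 ∈ (eumiB n a)ᶜ ∧ p.2 ≤ a * |p.1 ⟨0, hn⟩|}
  have hE : MeasurableSet E := by
    refine MeasurableSet.inter (measurable_fst (eumiB_meas n a).compl) ?_
    exact measurableSet_le (f := fun p : (Fin n → ℝ) × ℝ => p.2)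
      (g := fun p : (Fin n → ℝ) × ℝ => a * |p.1 ⟨0, hn⟩|) (by fun_prop) (by fun_prop)
  have hEle : P ((fun ω => ((fun i => X i ω), U ω)) ⁻¹' E)
      ≤ ∫⁻ x in (eumiB n a)ᶜ, ENNReal.ofReal (a * |x ⟨0, hn⟩|) ∂μ := by
    rw [← Measure.map_apply (by fun_prop) hE, hprod, Measure.prod_apply hE,
      ← lintegral_indicator (eumiB_meas n a).compl]
    refine lintegral_mono fun x => ?_
    by_cases hx : x ∈ (eumiB n a)ᶜ
    · rw [Set.indicator_of_mem hx]
      have h1 : a * |x ⟨0, hn⟩| ≤ 1 := by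
        by_contra hcon
        push Not at hcon
        refine hx (eumiB_mem n a x 1 le_rfl hn ?_)
        unfold eumiS
        refine le_trans ?_ (Finset.single_le_sum (f := fun i => ENNReal.ofReal (a * |x i|))
          (fun _ _ => zero_le) (a := ⟨0, hn⟩) (by simp))
        simpa using hcon.le
      refine (measure_mono (t := Set.Iic (a * |x ⟨0, hn⟩|)) fun u hu => hu.2).trans ?_
      rw [hνdef, Measure.map_apply hUmeas measurableSet_Iic]
      exact (hU _ ⟨by positivity, h1⟩).le
    · have : Prod.mk x ⁻¹' E = ∅ := by
        ext u
        simp only [Set.mem_preimage, Set.mem_empty_iff_false, iff_false]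
        exact fun h => hx h.1
      rw [this]
      simp
  have hsub : {ω | X ⟨0, hn⟩ ω ≥ U ω / a ∨
        ∃ t : ℕ, 1 ≤ t ∧ t ≤ n ∧
          |(t : ℝ)⁻¹ * ∑ i ∈ Finset.univ.filter (fun i : Fin n => (i : ℕ) < t), X i ω|
            ≥ 1 / a} ⊆ (fun ω => fun i => X i ω) ⁻¹' (eumiB n a) ∪
            (fun ω => ((fun i => X i ω), U ω)) ⁻¹' E := by
    intro ω hω
    by_cases hB : (fun i => X i ω) ∈ eumiB n a
    · exact Or.inl hB
    refine Or.inr ⟨hB, ?_⟩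
    rcases hω with h | ⟨t, ht, htn, h⟩
    · have h2 : U ω ≤ X ⟨0, hn⟩ ω * a := (div_le_iff₀ ha).1 h
      have h3 := le_abs_self (X ⟨0, hn⟩ ω)
      show U ω ≤ a * |X ⟨0, hn⟩ ω|
      nlinarith
    · exfalso
      refine hB (eumiB_mem n a _ t ht htn ?_)
      have htpos : (0 : ℝ) < t := by exact_mod_cast ht
      unfold eumiS
      rw [← ENNReal.ofReal_sum_of_nonneg (fun i _ => by positivity), ← Finset.mul_sum,
        ← ENNReal.ofReal_natCast]
      refine ENNReal.ofReal_le_ofReal ?_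
      rw [abs_mul, abs_of_pos (inv_pos.2 htpos), ge_iff_le, div_le_iff₀ ha, inv_mul_eq_div,
        div_mul_eq_mul_div, le_div_iff₀ htpos, one_mul] at h
      rw [mul_comm]
      exact h.trans (mul_le_mul_of_nonneg_right (Finset.abs_sum_le_sum_abs _ _) ha.le)
  calc _ ≤ P ((fun ω => fun i => X i ω) ⁻¹' (eumiB n a)) +
            P ((fun ω => ((fun i => X i ω), U ω)) ⁻¹' E) :=
          (measure_mono hsub).trans (measure_union_le _ _)
    _ ≤ ∫⁻ x in eumiB n a, ENNReal.ofReal (a * |x ⟨0, hn⟩|) ∂μ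
        + ∫⁻ x in (eumiB n a)ᶜ, ENNReal.ofReal (a * |x ⟨0, hn⟩|) ∂μ := by
          refine add_le_add ?_ hEle
          rw [← Measure.map_apply hXm (eumiB_meas n a)]
          exact eumiB_le n hn a μ hinv
    _ = ∫⁻ x, ENNReal.ofReal (a * |x ⟨0, hn⟩|) ∂μ := lintegral_add_compl _ (eumiB_meas n a)
    _ = ∫⁻ ω, ENNReal.ofReal (a * |X ⟨0, hn⟩ ω|) ∂P := by
          rw [hμdef, lintegral_map (by fun_prop) hXm]
    _ = ENNReal.ofReal (a * ∫ ω, |X ⟨0, hn⟩ ω| ∂P) := by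
          rw [← integral_const_mul, ofReal_integral_eq_lintegral_ofReal
            ((hint _).abs.const_mul a) (Filter.Eventually.of_forall fun ω => by positivity)]
end

section
/- Let X_1,…,X_K be nonnegative random variables, each with E[X_i] ≤ 1 under every distribution P in a family 𝒫 (i.e., each X_i is an e-value for the null H_0 : P ∈ 𝒫). Let π be a uniformly random permutation of {1,…,K} independent of the data (or the identity permutation if the X_i are exchangeable), let X̄^π_t = (1/t) ∑_{i=1}^t X_{π(i)}, let X̄_K = (X_1 + ⋯ + X_K)/K, and let U be uniformly distributed on [0,1], independent of everything else. Then under every P ∈ 𝒫 and any α ∈ (0,1): (1) P( X̄_K ≥ U/α ) ≤ α; (2) P( sup_{1 ≤ t ≤ K} X̄^π_t ≥ 1/α ) ≤ α; (3) P( X_{π(1)} ≥ U/α or sup_{1 ≤ t ≤ K} X̄^π_t ≥ 1/α ) ≤ α. -/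
open MeasureTheory ProbabilityTheory
open scoped ENNReal BigOperators

/-- Permutations of `Fin K` carry the discrete σ-algebra. -/
instance (K : ℕ) : MeasurableSpace (Equiv.Perm (Fin K)) := ⊤

instance (K : ℕ) : Nonempty (Equiv.Perm (Fin K)) := ⟨1⟩

/-- Partial sum of the first `t` coordinates. -/
def pSum {K : ℕ} (t : ℕ) (y : Fin K → ℝ) : ℝ :=
  ∑ i ∈ Finset.univ.filter (fun i : Fin K => (i : ℕ) < t), y i

lemma pSum_measurable {K : ℕ} (t : ℕ) : Measurable (pSum (K := K) t) := by
  unfold pSum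
  fun_prop

lemma pSum_swap {K : ℕ} {t s : ℕ} (hts : t ≤ s) (i j : Fin K) (hi : (i : ℕ) < t)
    (hj : (j : ℕ) < t) (y : Fin K → ℝ) :
    pSum s (fun k => y (Equiv.swap i j k)) = pSum s y := by
  unfold pSum
  refine Finset.sum_equiv (Equiv.swap i j) ?_ (fun _ _ => rfl)
  intro k
  simp only [Finset.mem_filter, Finset.mem_univ, true_and]
  by_cases h1 : k = i
  · subst h1; simp; omega
  by_cases h2 : k = j
  · subst h2; simp; omega
  rw [Equiv.swap_apply_of_ne_of_ne h1 h2]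

/-- The event that some running mean is at least `1/α`. -/
def evA (K : ℕ) (α : ℝ) : Set (Fin K → ℝ) :=
  {y | ∃ t : ℕ, 1 ≤ t ∧ t ≤ K ∧ (t : ℝ)⁻¹ * pSum t y ≥ 1 / α}

/-- The event that the last such running mean is at time `t`. -/
def evB (K : ℕ) (α : ℝ) (t : ℕ) : Set (Fin K → ℝ) :=
  {y | (t : ℝ)⁻¹ * pSum t y ≥ 1 / α} ∩
    {y | ∀ s : ℕ, t < s → s ≤ K → (s : ℝ)⁻¹ * pSum s y < 1 / α}

lemma evB_meas (K : ℕ) (α : ℝ) (t : ℕ) : MeasurableSet (evB K α t) := by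
  unfold evB
  refine MeasurableSet.inter ?_ ?_
  · exact measurableSet_le measurable_const ((pSum_measurable t).const_mul _)
  · simp only [Set.setOf_forall]
    refine MeasurableSet.iInter fun s => MeasurableSet.iInter fun _ => MeasurableSet.iInter fun _ => ?_
    exact measurableSet_lt ((pSum_measurable s).const_mul _) measurable_const

lemma evA_eq (K : ℕ) (α : ℝ) : evA K α = ⋃ t ∈ Finset.Icc 1 K, evB K α t := by
  ext y
  simp only [Set.mem_iUnion, Finset.mem_Icc, exists_prop]
  constructor
  · intro h
    classical
    obtain ⟨t0, h1, h2, h3⟩ := h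
    let S := (Finset.Icc 1 K).filter (fun t : ℕ => (t : ℝ)⁻¹ * pSum t y ≥ 1 / α)
    have hS : S.Nonempty := ⟨t0, Finset.mem_filter.2 ⟨Finset.mem_Icc.2 ⟨h1, h2⟩, h3⟩⟩
    have hm := S.max'_mem hS
    have hm' := Finset.mem_filter.1 hm
    refine ⟨S.max' hS, Finset.mem_Icc.1 hm'.1, hm'.2, ?_⟩
    intro s hs hsK
    by_contra hcon
    have : s ∈ S := Finset.mem_filter.2
      ⟨Finset.mem_Icc.2 ⟨by omega, hsK⟩, not_lt.1 hcon⟩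
    have := S.le_max' s this
    omega
  · rintro ⟨t, ⟨h1, h2⟩, h3, -⟩
    exact ⟨t, h1, h2, h3⟩

lemma evB_disj (K : ℕ) (α : ℝ) :
    Set.PairwiseDisjoint (↑(Finset.Icc 1 K)) (evB K α) := by
  have key : ∀ s t, s < t → t ≤ K → Disjoint (evB K α s) (evB K α t) := by
    intro s t hst ht
    rw [Set.disjoint_left]
    rintro y ⟨-, h⟩ ⟨h', -⟩
    exact absurd (h t hst ht) (not_lt.2 h')
  intro s hs t ht hne
  simp only [Finset.coe_Icc, Set.mem_Icc] at hs ht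
  rcases lt_or_gt_of_ne hne with h | h
  · exact key s t h ht.2
  · exact (key t s h hs.2).symm

lemma evB_bound {K : ℕ} (hK : 0 < K) (ν : Measure (Fin K → ℝ))
    (hex : ∀ π : Equiv.Perm (Fin K), Measure.map (fun y i => y (π i)) ν = ν)
    (α : ℝ) (hα : 0 < α) (t : ℕ) (ht : 1 ≤ t) (htK : t ≤ K) :
    ν (evB K α t) ≤ ENNReal.ofReal α *
      ∫⁻ y in evB K α t, ENNReal.ofReal (y ⟨0, hK⟩) ∂ν := by
  have hsw : ∀ i : Fin K, (i : ℕ) < t →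
      ∫⁻ y in evB K α t, ENNReal.ofReal (y i) ∂ν =
      ∫⁻ y in evB K α t, ENNReal.ofReal (y ⟨0, hK⟩) ∂ν := by
    intro i hi
    have hg : Measurable (fun (y : Fin K → ℝ) k => y (Equiv.swap i ⟨0, hK⟩ k)) := by fun_prop
    conv_lhs => rw [← hex (Equiv.swap i ⟨0, hK⟩)]
    rw [setLIntegral_map (evB_meas K α t) (by fun_prop) hg]
    have : (fun (y : Fin K → ℝ) k => y (Equiv.swap i ⟨0, hK⟩ k)) ⁻¹' evB K α t = evB K α t := by
      ext y
      have h1 := fun s (hs : t ≤ s) =>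
        pSum_swap hs i ⟨0, hK⟩ hi (by simp; omega) y
      simp only [evB, Set.mem_preimage, Set.mem_inter_iff, Set.mem_setOf_eq, h1 t le_rfl]
      refine and_congr_right fun _ => forall_congr' fun s => ?_
      refine forall_congr' fun hs => ?_
      rw [h1 s hs.le]
    rw [this]
    simp
  have htpos : (0 : ℝ) < t := by exact_mod_cast ht
  have hcard : (Finset.univ.filter (fun i : Fin K => (i : ℕ) < t)).card = t := by
    rw [Fin.card_filter_val_lt]; omega
  calc ν (evB K α t) = ∫⁻ y in evB K α t, 1 ∂ν := by simp
    _ ≤ ∫⁻ y in evB K α t, ENNReal.ofReal (α * (t : ℝ)⁻¹) *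
          ∑ i ∈ Finset.univ.filter (fun i : Fin K => (i : ℕ) < t), ENNReal.ofReal (y i) ∂ν := by
        refine setLIntegral_mono' (evB_meas K α t) ?_
        intro y hy
        have h1 : (1 : ℝ) ≤ (α * (t : ℝ)⁻¹) * pSum t y := by
          have := hy.1
          simp only [Set.mem_setOf_eq, ge_iff_le, div_le_iff₀ hα] at this
          linarith
        calc (1 : ℝ≥0∞) = ENNReal.ofReal 1 := by simp
          _ ≤ ENNReal.ofReal ((α * (t : ℝ)⁻¹) * pSum t y) := ENNReal.ofReal_le_ofReal h1
          _ = ENNReal.ofReal (α * (t : ℝ)⁻¹) * ENNReal.ofReal (pSum t y) :=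
              ENNReal.ofReal_mul (by positivity)
          _ ≤ _ := by
              gcongr
              unfold pSum
              exact Finset.le_sum_of_subadditive _ ENNReal.ofReal_zero.le
                (fun _ _ => ENNReal.ofReal_add_le) _ _
    _ = ENNReal.ofReal (α * (t : ℝ)⁻¹) * ∑ i ∈ Finset.univ.filter (fun i : Fin K => (i : ℕ) < t),
          ∫⁻ y in evB K α t, ENNReal.ofReal (y i) ∂ν := by
        rw [lintegral_const_mul _ (by fun_prop), lintegral_finsetSum _ (by intros; fun_prop)]
    _ = ENNReal.ofReal (α * (t : ℝ)⁻¹) * (t *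
          ∫⁻ y in evB K α t, ENNReal.ofReal (y ⟨0, hK⟩) ∂ν) := by
        rw [Finset.sum_congr rfl (fun i hi => hsw i (Finset.mem_filter.1 hi).2),
          Finset.sum_const, hcard, nsmul_eq_mul]
    _ = _ := by
        rw [← mul_assoc, ← ENNReal.ofReal_natCast t, ← ENNReal.ofReal_mul (by positivity)]
        congr 2
        field_simp

lemma evA_meas (K : ℕ) (α : ℝ) : MeasurableSet (evA K α) := by
  rw [evA_eq]
  exact Finset.measurableSet_biUnion _ fun t _ => evB_meas K α t

lemma evA_bound {K : ℕ} (hK : 0 < K) (ν : Measure (Fin K → ℝ))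
    (hex : ∀ π : Equiv.Perm (Fin K), Measure.map (fun y i => y (π i)) ν = ν)
    (α : ℝ) (hα : 0 < α) :
    ν (evA K α) ≤ ENNReal.ofReal α *
      ∫⁻ y in evA K α, ENNReal.ofReal (y ⟨0, hK⟩) ∂ν := by
  rw [evA_eq, lintegral_biUnion_finset (evB_disj K α) (fun t _ => evB_meas K α t),
    Finset.mul_sum]
  refine (measure_biUnion_finset_le _ _).trans (Finset.sum_le_sum fun t ht => ?_)
  rw [Finset.mem_Icc] at ht
  exact evB_bound hK ν hex α hα t ht.1 ht.2

lemma unif_bound {Ω E : Type*} [MeasurableSpace Ω] [MeasurableSpace E] (P : Measure Ω)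
    [IsProbabilityMeasure P] (Z : Ω → E) (hZ : Measurable Z) (U : Ω → ℝ) (hUm : Measurable U)
    (hU : ∀ u ∈ Set.Icc (0 : ℝ) 1, P {ω | U ω ≤ u} = ENNReal.ofReal u)
    (hind : IndepFun Z U P) (g : E → ℝ) (hg : Measurable g) (hg0 : ∀ ω, 0 ≤ g (Z ω))
    (B : Set E) (hB : MeasurableSet B) :
    P {ω | U ω ≤ g (Z ω) ∧ Z ω ∈ B} ≤ ∫⁻ z in B, ENNReal.ofReal (g z) ∂(P.map Z) := by
  have hprod := (indepFun_iff_map_prod_eq_prod_map_map hZ.aemeasurable hUm.aemeasurable).1 hind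
  have := Measure.isProbabilityMeasure_map (μ := P) hZ.aemeasurable
  have := Measure.isProbabilityMeasure_map (μ := P) hUm.aemeasurable
  have hS : MeasurableSet {p : E × ℝ | p.2 ≤ g p.1 ∧ p.1 ∈ B} :=
    (measurableSet_le measurable_snd (hg.comp measurable_fst)).inter (measurable_fst hB)
  have h1 : P {ω | U ω ≤ g (Z ω) ∧ Z ω ∈ B} =
      P.map (fun ω => (Z ω, U ω)) {p : E × ℝ | p.2 ≤ g p.1 ∧ p.1 ∈ B} := by
    rw [Measure.map_apply (hZ.prodMk hUm) hS]; rfl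
  rw [h1, hprod, Measure.prod_apply hS, ← lintegral_indicator hB]
  have hae : ∀ᵐ z ∂(P.map Z), 0 ≤ g z := by
    rw [ae_map_iff hZ.aemeasurable (measurableSet_le measurable_const hg)]
    exact Filter.Eventually.of_forall hg0
  refine lintegral_mono_ae ?_
  filter_upwards [hae] with z hz
  by_cases hzB : z ∈ B
  · rw [Set.indicator_of_mem hzB]
    have h2 : Prod.mk z ⁻¹' {p : E × ℝ | p.2 ≤ g p.1 ∧ p.1 ∈ B} = Set.Iic (g z) := by
      ext u; simp [hzB]
    rw [h2]
    by_cases h3 : g z ≤ 1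
    · rw [Measure.map_apply hUm measurableSet_Iic]
      exact (hU _ ⟨hz, h3⟩).le
    · refine prob_le_one.trans ?_
      rw [ENNReal.one_le_ofReal]; linarith
  · have h2 : Prod.mk z ⁻¹' {p : E × ℝ | p.2 ≤ g p.1 ∧ p.1 ∈ B} = ∅ := by
      ext u; simp [hzB]
    rw [h2]; simp

instance permDiscrete (K : ℕ) : DiscreteMeasurableSpace (Equiv.Perm (Fin K)) :=
  ⟨fun _ => trivial⟩

lemma permAct_meas (K : ℕ) :
    Measurable (fun p : (Fin K → ℝ) × Equiv.Perm (Fin K) => fun i => p.1 (p.2 i)) := by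
  refine measurable_from_prod_countable_left fun σ => ?_
  exact measurable_pi_lambda _ fun i => measurable_pi_apply (σ i)

lemma exch {Ω : Type*} [MeasurableSpace Ω] (P : Measure Ω) [IsProbabilityMeasure P] (K : ℕ)
    (X : Fin K → Ω → ℝ) (hmeas : ∀ i, Measurable (X i))
    (prm : Ω → Equiv.Perm (Fin K)) (hprm_meas : Measurable prm)
    (h1 : Measure.map prm P = (PMF.uniformOfFintype (Equiv.Perm (Fin K))).toMeasure)
    (h2 : IndepFun (fun ω => fun i => X i ω) prm P) (π : Equiv.Perm (Fin K)) :
    Measure.map (fun ω i => X (prm ω (π i)) ω) P = Measure.map (fun ω i => X (prm ω i) ω) P := by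
  have hXm : Measurable (fun ω => fun i => X i ω) := by fun_prop
  have hpair : Measurable (fun ω => ((fun i => X i ω), prm ω)) := hXm.prodMk hprm_meas
  have hY : Measurable (fun ω i => X (prm ω i) ω) := (permAct_meas K).comp hpair
  have hYπ : Measurable (fun ω i => X (prm ω (π i)) ω) := by
    have : Measurable (fun (y : Fin K → ℝ) i => y (π i)) := by fun_prop
    exact this.comp hY
  have key : ∀ (ρ : Equiv.Perm (Fin K)) (S : Set (Fin K → ℝ)), MeasurableSet S →
      P {ω | (fun i => X (prm ω (ρ i)) ω) ∈ S} =
      ∑ σ : Equiv.Perm (Fin K), P {ω | (fun i => X ((σ * ρ) i) ω) ∈ S} *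
        (Fintype.card (Equiv.Perm (Fin K)) : ℝ≥0∞)⁻¹ := by
    intro ρ S hS
    have hdec : {ω | (fun i => X (prm ω (ρ i)) ω) ∈ S} =
        ⋃ σ ∈ (Finset.univ : Finset (Equiv.Perm (Fin K))),
          ({ω | (fun i => X ((σ * ρ) i) ω) ∈ S} ∩ prm ⁻¹' {σ}) := by
      ext ω
      simp
    have hm : ∀ σ : Equiv.Perm (Fin K), MeasurableSet {ω | (fun i => X ((σ * ρ) i) ω) ∈ S} := by
      intro σ
      have : Measurable (fun ω => fun i => X ((σ * ρ) i) ω) := by fun_prop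
      exact this hS
    rw [hdec, measure_biUnion_finset]
    · refine Finset.sum_congr rfl fun σ _ => ?_
      have hT : MeasurableSet {x : Fin K → ℝ | (fun i => x ((σ * ρ) i)) ∈ S} := by
        have : Measurable (fun (x : Fin K → ℝ) i => x ((σ * ρ) i)) := by fun_prop
        exact this hS
      have h3 := h2.measure_inter_preimage_eq_mul _ _ hT (MeasurableSet.singleton σ)
      have h4 : P (prm ⁻¹' {σ}) = (Fintype.card (Equiv.Perm (Fin K)) : ℝ≥0∞)⁻¹ := by
        rw [← Measure.map_apply hprm_meas (MeasurableSet.singleton σ), h1,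
          PMF.toMeasure_apply_singleton _ _ (MeasurableSet.singleton σ),
          PMF.uniformOfFintype_apply]
      rw [h4] at h3
      exact h3
    · intro a _ b _ hab
      refine Set.disjoint_left.2 ?_
      rintro ω ⟨-, ha⟩ ⟨-, hb⟩
      exact hab (ha.symm.trans hb)
    · intro σ _
      exact (hm σ).inter (hprm_meas (MeasurableSet.singleton σ))
  ext S hS
  rw [Measure.map_apply hYπ hS, Measure.map_apply hY hS]
  refine (key π S hS).trans (Eq.trans ?_ (key 1 S hS).symm)
  simp only [mul_one]
  exact Equiv.sum_comp (Equiv.mulRight π)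
    (fun σ : Equiv.Perm (Fin K) => P {ω | (fun i => X (σ i) ω) ∈ S} *
        (Fintype.card (Equiv.Perm (Fin K)) : ℝ≥0∞)⁻¹)

/-- **Randomized tests with arbitrarily dependent e-values.** Let `Pfam` be a
family of distributions and let `X 0, …, X (K-1)` be nonnegative random
variables, each with `E_Q[X i] ≤ 1` for every `Q ∈ Pfam` (e-values for
`H₀ : P ∈ Pfam`). Let `prm` be a uniformly random permutation of `{0,…,K-1}`
independent of the data (or the identity permutation if the `X i` are
exchangeable), and let `U` be uniform on `[0,1]` independent of everything else.
Then under any `P ∈ Pfam` and for any `α ∈ (0,1)`: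
(1) `P( X̄_K ≥ U/α ) ≤ α`;
(2) `P( max_{1 ≤ t ≤ K} X̄^prm_t ≥ 1/α ) ≤ α`;
(3) `P( X_{prm 0} ≥ U/α or max_{1 ≤ t ≤ K} X̄^prm_t ≥ 1/α ) ≤ α`. -/
theorem randomized_tests_with_dependent_e_values
    {Ω : Type*} [MeasurableSpace Ω] (Pfam : Set (Measure Ω))
    (P : Measure Ω) (hP : P ∈ Pfam) [IsProbabilityMeasure P]
    (K : ℕ) (hK : 0 < K)
    (X : Fin K → Ω → ℝ)
    (hmeas : ∀ i, Measurable (X i))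
    (hnn : ∀ i ω, 0 ≤ X i ω)
    (he : ∀ Q ∈ Pfam, ∀ i, ∫⁻ ω, ENNReal.ofReal (X i ω) ∂Q ≤ 1)
    (prm : Ω → Equiv.Perm (Fin K)) (hprm_meas : Measurable prm)
    (hprm : (Measure.map prm P = (PMF.uniformOfFintype (Equiv.Perm (Fin K))).toMeasure
              ∧ IndepFun (fun ω => fun i => X i ω) prm P)
          ∨ ((∀ ω, prm ω = Equiv.refl (Fin K))
              ∧ ∀ π : Equiv.Perm (Fin K),
                  Measure.map (fun ω => fun i => X (π i) ω) P
                    = Measure.map (fun ω => fun i => X i ω) P))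
    (U : Ω → ℝ) (hUmeas : Measurable U)
    (hU : ∀ u ∈ Set.Icc (0 : ℝ) 1, P {ω | U ω ≤ u} = ENNReal.ofReal u)
    (hindepU : IndepFun (fun ω => ((fun i => X i ω), prm ω)) U P)
    (α : ℝ) (hα : 0 < α) (hα1 : α < 1) :
    P {ω | (K : ℝ)⁻¹ * ∑ i, X i ω ≥ U ω / α} ≤ ENNReal.ofReal α
    ∧ P {ω | ∃ t : ℕ, 1 ≤ t ∧ t ≤ K ∧
          (t : ℝ)⁻¹ * ∑ i ∈ Finset.univ.filter (fun i : Fin K => (i : ℕ) < t),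
            X (prm ω i) ω ≥ 1 / α}
        ≤ ENNReal.ofReal α
    ∧ P {ω | X (prm ω ⟨0, hK⟩) ω ≥ U ω / α ∨
          ∃ t : ℕ, 1 ≤ t ∧ t ≤ K ∧
            (t : ℝ)⁻¹ * ∑ i ∈ Finset.univ.filter (fun i : Fin K => (i : ℕ) < t),
              X (prm ω i) ω ≥ 1 / α}
        ≤ ENNReal.ofReal α := by
  have he' := he P hP
  have hXm : Measurable (fun ω => fun i => X i ω) := by fun_prop
  have hpair : Measurable (fun ω => ((fun i => X i ω), prm ω)) := hXm.prodMk hprm_meas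
  have hY : Measurable (fun ω i => X (prm ω i) ω) := (permAct_meas K).comp hpair
  have hKpos : (0 : ℝ) < K := by exact_mod_cast hK
  have hex : ∀ π : Equiv.Perm (Fin K), Measure.map (fun y i => y (π i))
      (Measure.map (fun ω i => X (prm ω i) ω) P) = Measure.map (fun ω i => X (prm ω i) ω) P := by
    intro π
    rw [Measure.map_map (by fun_prop) hY]
    rcases hprm with ⟨h1, h2⟩ | ⟨h1, h2⟩
    · exact exch P K X hmeas prm hprm_meas h1 h2 π
    · simp only [h1, Equiv.refl_apply]
      exact h2 π
  have hXU : IndepFun (fun ω => fun i => X i ω) U P :=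
    hindepU.comp measurable_fst measurable_id
  have hYU : IndepFun (fun ω i => X (prm ω i) ω) U P :=
    hindepU.comp (permAct_meas K) measurable_id
  have hsumX : ∑ i, ∫⁻ ω, ENNReal.ofReal (X i ω) ∂P ≤ K := by
    refine (Finset.sum_le_sum fun i _ => he' i).trans ?_
    simp
  set ν := Measure.map (fun ω i => X (prm ω i) ω) P with hν
  have hmean : ∫⁻ y, ENNReal.ofReal (y ⟨0, hK⟩) ∂ν ≤ 1 := by
    have h1 : ∀ i, ∫⁻ y, ENNReal.ofReal (y i) ∂ν = ∫⁻ y, ENNReal.ofReal (y ⟨0, hK⟩) ∂ν := by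
      intro i
      conv_lhs => rw [← hex (Equiv.swap i ⟨0, hK⟩)]
      rw [lintegral_map (by fun_prop) (by fun_prop)]
      simp
    have h2 : (K : ℝ≥0∞) * ∫⁻ y, ENNReal.ofReal (y ⟨0, hK⟩) ∂ν ≤ K * 1 := by
      calc (K : ℝ≥0∞) * ∫⁻ y, ENNReal.ofReal (y ⟨0, hK⟩) ∂ν
          = ∑ i : Fin K, ∫⁻ y, ENNReal.ofReal (y i) ∂ν := by
            rw [Finset.sum_congr rfl (fun i _ => h1 i)]; simp
        _ = ∫⁻ y, ∑ i : Fin K, ENNReal.ofReal (y i) ∂ν := by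
            rw [lintegral_finsetSum _ (by intros; fun_prop)]
        _ = ∫⁻ ω, ∑ i : Fin K, ENNReal.ofReal (X (prm ω i) ω) ∂P := by
            rw [hν, lintegral_map (by fun_prop) hY]
        _ = ∫⁻ ω, ∑ i : Fin K, ENNReal.ofReal (X i ω) ∂P := by
            refine lintegral_congr fun ω => ?_
            exact Equiv.sum_comp (prm ω) (fun i => ENNReal.ofReal (X i ω))
        _ = ∑ i, ∫⁻ ω, ENNReal.ofReal (X i ω) ∂P := by
            rw [lintegral_finsetSum _ (fun i _ => (hmeas i).ennreal_ofReal)]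
        _ ≤ K * 1 := by rw [mul_one]; exact hsumX
    exact (ENNReal.mul_le_mul_iff_right (by exact_mod_cast hK.ne') (by simp)).1 h2
  have h3 : P {ω | X (prm ω ⟨0, hK⟩) ω ≥ U ω / α ∨
          ∃ t : ℕ, 1 ≤ t ∧ t ≤ K ∧
            (t : ℝ)⁻¹ * ∑ i ∈ Finset.univ.filter (fun i : Fin K => (i : ℕ) < t),
              X (prm ω i) ω ≥ 1 / α}
        ≤ ENNReal.ofReal α := by
    have hb := unif_bound P _ hY U hUmeas hU hYU (fun y => α * y ⟨0, hK⟩) (by fun_prop)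
      (fun ω => mul_nonneg hα.le (hnn _ _)) (evA K α)ᶜ (evA_meas K α).compl
    have ha := evA_bound hK ν hex α hα
    calc _ ≤ P ((fun ω i => X (prm ω i) ω) ⁻¹' evA K α ∪
            {ω | U ω ≤ α * X (prm ω ⟨0, hK⟩) ω ∧
              (fun i => X (prm ω i) ω) ∈ (evA K α)ᶜ}) := by
          refine measure_mono ?_
          intro ω hω
          by_cases hA : (fun i => X (prm ω i) ω) ∈ evA K α
          · exact Or.inl hA
          · refine Or.inr ⟨?_, hA⟩
            rcases hω with h | h
            · rw [ge_iff_le, div_le_iff₀ hα] at h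
              linarith
            · exact absurd h hA
      _ ≤ ν (evA K α) + ∫⁻ y in (evA K α)ᶜ, ENNReal.ofReal (α * y ⟨0, hK⟩) ∂ν := by
          refine (measure_union_le _ _).trans (add_le_add ?_ hb)
          rw [hν, Measure.map_apply hY (evA_meas K α)]
      _ ≤ ENNReal.ofReal α * ∫⁻ y in evA K α, ENNReal.ofReal (y ⟨0, hK⟩) ∂ν +
            ENNReal.ofReal α * ∫⁻ y in (evA K α)ᶜ, ENNReal.ofReal (y ⟨0, hK⟩) ∂ν := by
          refine add_le_add ha (le_of_eq ?_)
          simp only [ENNReal.ofReal_mul hα.le]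
          rw [lintegral_const_mul _ (by fun_prop)]
      _ = ENNReal.ofReal α * ∫⁻ y, ENNReal.ofReal (y ⟨0, hK⟩) ∂ν := by
          rw [← mul_add, lintegral_add_compl _ (evA_meas K α)]
      _ ≤ ENNReal.ofReal α * 1 := by gcongr
      _ = ENNReal.ofReal α := mul_one _
  refine ⟨?_, (measure_mono fun ω hω => Or.inr hω).trans h3, h3⟩
  have hb := unif_bound P _ hXm U hUmeas hU hXU (fun y => α * ((K : ℝ)⁻¹ * ∑ i, y i))
    (by fun_prop)
    (fun ω => mul_nonneg hα.le (mul_nonneg (by positivity) (Finset.sum_nonneg fun i _ => hnn i ω)))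
    Set.univ MeasurableSet.univ
  calc _ ≤ P {ω | U ω ≤ α * ((K : ℝ)⁻¹ * ∑ i, X i ω) ∧ (fun i => X i ω) ∈ Set.univ} := by
        refine measure_mono fun ω hω => ⟨?_, trivial⟩
        simp only [Set.mem_setOf_eq, ge_iff_le, div_le_iff₀ hα] at hω
        linarith
    _ ≤ _ := hb
    _ = ∫⁻ ω, ENNReal.ofReal (α * ((K : ℝ)⁻¹ * ∑ i, X i ω)) ∂P := by
        rw [Measure.restrict_univ, lintegral_map (by fun_prop) hXm]
    _ = ∫⁻ ω, ENNReal.ofReal (α * (K : ℝ)⁻¹) * ∑ i, ENNReal.ofReal (X i ω) ∂P := by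
        refine lintegral_congr fun ω => ?_
        rw [← mul_assoc, ENNReal.ofReal_mul (by positivity),
          ENNReal.ofReal_sum_of_nonneg (fun i _ => hnn i ω)]
    _ = ENNReal.ofReal (α * (K : ℝ)⁻¹) * ∑ i, ∫⁻ ω, ENNReal.ofReal (X i ω) ∂P := by
        rw [lintegral_const_mul _
          (Finset.measurable_fun_sum _ fun i _ => (hmeas i).ennreal_ofReal),
          lintegral_finsetSum _ (fun i _ => (hmeas i).ennreal_ofReal)]
    _ ≤ ENNReal.ofReal (α * (K : ℝ)⁻¹) * K := by gcongr
    _ = ENNReal.ofReal α := by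
        rw [← ENNReal.ofReal_natCast K, ← ENNReal.ofReal_mul (by positivity)]
        congr 1
        field_simp
end

section
/- Let X be a random variable taking values in a set 𝒳 ⊆ ℝ, let I ⊆ [0,∞) be an interval, and let f : 𝒳 → I and g : I → 𝒳 be nondecreasing Borel-measurable functions with f(g(z)) ≥ z for every z ∈ I. Let U be uniformly distributed on [0,1] and independent of X. Then for any x ∈ 𝒳 with f(x) > 0, P( X ≥ g(U·f(x)) ) ≤ E[f(X)]/f(x). -/
open MeasureTheory ProbabilityTheory
open scoped ENNReal

/-- **General randomized tail bound.** Let `X` take values in `𝓧 ⊆ ℝ`, let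
`I ⊆ [0,∞)` be an interval, and let `f : 𝓧 → I` and `g : I → 𝓧` be nondecreasing
Borel-measurable functions with `f (g z) ≥ z` for every `z ∈ I`. Let `U` be
uniform on `[0,1]`, independent of `X`. Then for any `x ∈ 𝓧` with `f x > 0`,
`P( X ≥ g (U · f x) ) ≤ E[f X] / f x`, where the expectation is a Lebesgue
integral so that the bound is trivially `∞` in the nonintegrable case. (As in
the paper, `U · f x` takes values in `I`, which is recorded as the hypothesis
`hUI`.) -/
theorem general_randomized_tail_bound
    {Ω : Type*} [MeasurableSpace Ω] (P : Measure Ω) [IsProbabilityMeasure P]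
    (𝓧 I : Set ℝ) (hI : I ⊆ Set.Ici (0 : ℝ)) (hIinterval : I.OrdConnected)
    (f g : ℝ → ℝ)
    (hfmeas : Measurable f) (hgmeas : Measurable g)
    (hfmono : MonotoneOn f 𝓧) (hgmono : MonotoneOn g I)
    (hfmaps : Set.MapsTo f 𝓧 I) (hgmaps : Set.MapsTo g I 𝓧)
    (hfg : ∀ z ∈ I, z ≤ f (g z))
    (X : Ω → ℝ) (hXmeas : Measurable X) (hX : ∀ ω, X ω ∈ 𝓧)
    (U : Ω → ℝ) (hUmeas : Measurable U)
    (hU : ∀ u ∈ Set.Icc (0 : ℝ) 1, P {ω | U ω ≤ u} = ENNReal.ofReal u)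
    (hindep : IndepFun X U P)
    (x : ℝ) (hx : x ∈ 𝓧) (hfx : 0 < f x)
    (hUI : ∀ u ∈ Set.Icc (0 : ℝ) 1, u * f x ∈ I) :
    P {ω | X ω ≥ g (U ω * f x)}
      ≤ (∫⁻ ω, ENNReal.ofReal (f (X ω)) ∂P) / ENNReal.ofReal (f x) := by
  have hcdf : ∀ y : ℝ, P {ω | U ω ≤ y} ≤ ENNReal.ofReal y := by
    intro y
    rcases le_total y 0 with hy | hy
    · calc P {ω | U ω ≤ y} ≤ P {ω | U ω ≤ 0} :=
            measure_mono (fun ω (h : U ω ≤ y) => le_trans h hy)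
        _ = ENNReal.ofReal 0 := hU 0 (by simp)
        _ ≤ ENNReal.ofReal y := by simp
    · rcases le_total y 1 with hy1 | hy1
      · exact (hU y ⟨hy, hy1⟩).le
      · exact prob_le_one.trans (by simpa using ENNReal.ofReal_le_ofReal hy1)
  have h0 : ∀ᵐ ω ∂P, 0 < U ω := by
    rw [ae_iff]
    simpa using hU 0 (by simp)
  have h1 : ∀ᵐ ω ∂P, U ω ≤ 1 := by
    refine (prob_compl_eq_zero_iff (s := {ω | U ω ≤ 1})
      (measurableSet_le hUmeas measurable_const)).2 ?_
    simpa using hU 1 (by simp)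
  have hstep : P {ω | X ω ≥ g (U ω * f x)} ≤ P {ω | U ω ≤ f (X ω) / f x} := by
    apply measure_mono_ae
    filter_upwards [h0, h1] with ω h0 h1 h
    have hm := hUI (U ω) ⟨h0.le, h1⟩
    have h2 := hfmono (hgmaps hm) (hX ω) h
    exact (le_div_iff₀ hfx).2 ((hfg _ hm).trans h2)
  refine hstep.trans ?_
  have hS : MeasurableSet {p : ℝ × ℝ | p.2 ≤ f p.1 / f x} :=
    measurableSet_le measurable_snd ((hfmeas.comp measurable_fst).div_const _)
  have hprod := (indepFun_iff_map_prod_eq_prod_map_map hXmeas.aemeasurable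
    hUmeas.aemeasurable).1 hindep
  have : IsProbabilityMeasure (P.map U) := Measure.isProbabilityMeasure_map hUmeas.aemeasurable
  calc P {ω | U ω ≤ f (X ω) / f x}
      = (P.map (fun ω => (X ω, U ω))) {p : ℝ × ℝ | p.2 ≤ f p.1 / f x} := by
        rw [Measure.map_apply (hXmeas.prodMk hUmeas) hS]; rfl
    _ = ∫⁻ a, (P.map U) (Prod.mk a ⁻¹' {p : ℝ × ℝ | p.2 ≤ f p.1 / f x}) ∂(P.map X) := by
        rw [hprod, Measure.prod_apply hS]
    _ ≤ ∫⁻ a, ENNReal.ofReal (f a) / ENNReal.ofReal (f x) ∂(P.map X) := by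
        apply lintegral_mono
        intro a
        dsimp only
        rw [Measure.map_apply hUmeas (measurable_prodMk_left hS), ← ENNReal.ofReal_div_of_pos hfx]
        exact hcdf _
    _ = ∫⁻ ω, ENNReal.ofReal (f (X ω)) / ENNReal.ofReal (f x) ∂P :=
        lintegral_map (hfmeas.ennreal_ofReal.div_const _) hXmeas
    _ = _ := by
        simp only [div_eq_mul_inv]
        exact lintegral_mul_const _ (hfmeas.comp hXmeas).ennreal_ofReal
end

section
/- Let X be a real-valued random variable with mean E[X] and variance at most σ² > 0, and let U be uniformly distributed on [0,1], independent of X. Then for any k > 0, P( X − E[X] ≥ √U·(kσ + σ/k) − σ/k ) ≤ 1/(k² + 1). -/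
open MeasureTheory ProbabilityTheory
open scoped ENNReal

/-- **Uniformly-randomized Cantelli inequality.** Let `X` have mean `μ` and
variance at most `σ² > 0`, and let `U` be uniform on `[0,1]`, independent of
`X`. Then for any `k > 0`,
`P( X − μ ≥ √U·(kσ + σ/k) − σ/k ) ≤ 1/(k² + 1)`. -/
theorem uniformly_randomized_cantelli_inequality
    {Ω : Type*} [MeasurableSpace Ω] (P : Measure Ω) [IsProbabilityMeasure P]
    (X U : Ω → ℝ) (hXmeas : Measurable X) (hUmeas : Measurable U)
    (σ μ : ℝ) (hσ : 0 < σ)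
    (hint : Integrable X P)
    (hsq : Integrable (fun ω => (X ω) ^ 2) P)
    (hmean : ∫ ω, X ω ∂P = μ)
    (hvar : ∫ ω, (X ω - μ) ^ 2 ∂P ≤ σ ^ 2)
    (hindep : IndepFun X U P)
    (hU : ∀ u ∈ Set.Icc (0 : ℝ) 1, P {ω | U ω ≤ u} = ENNReal.ofReal u)
    (k : ℝ) (hk : 0 < k) :
    P {ω | X ω - μ ≥ Real.sqrt (U ω) * (k * σ + σ / k) - σ / k}
      ≤ ENNReal.ofReal (1 / (k ^ 2 + 1)) := by
  have hc : 0 < k * σ + σ / k := by positivity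
  set c := k * σ + σ / k with hcdef
  let g : ℝ → ℝ := fun x => ((x - μ + σ / k) / c) ^ 2
  have hg : Measurable g := by fun_prop
  have hsub : {ω | X ω - μ ≥ Real.sqrt (U ω) * c - σ / k} ⊆
      (fun ω => (X ω, U ω)) ⁻¹' {p : ℝ × ℝ | p.2 ≤ g p.1} := by
    intro ω hω
    simp only [Set.mem_ofPred_eq, Set.mem_preimage, g] at hω ⊢
    have h1 : Real.sqrt (U ω) ≤ (X ω - μ + σ / k) / c := by
      rw [le_div_iff₀ hc]; linarith
    exact (Real.sqrt_le_left ((Real.sqrt_nonneg _).trans h1)).1 h1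
  have hS : MeasurableSet {p : ℝ × ℝ | p.2 ≤ g p.1} :=
    measurableSet_le measurable_snd (hg.comp measurable_fst)
  have hXc : Integrable (fun ω => X ω - μ) P := hint.sub (integrable_const μ)
  have hX2 : Integrable (fun ω => (X ω - μ) ^ 2) P := by
    have h : Integrable (fun ω => X ω ^ 2 - (2 * μ) * X ω + μ ^ 2) P :=
      (hsq.sub (hint.const_mul (2 * μ))).add (integrable_const (μ ^ 2))
    exact h.congr (Filter.Eventually.of_forall fun ω => by ring)
  have hgeq : (fun ω => g (X ω)) = fun ω =>
      (((X ω - μ) ^ 2 + (2 * (σ / k)) * (X ω - μ)) + (σ / k) ^ 2) * (c ^ 2)⁻¹ := by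
    funext ω
    simp only [g]
    rw [div_pow, div_eq_mul_inv]; ring
  have hgint : Integrable (fun ω => g (X ω)) P := by
    rw [hgeq]
    exact ((hX2.add (hXc.const_mul _)).add (integrable_const _)).mul_const _
  have hmean0 : ∫ ω, (X ω - μ) ∂P = 0 := by
    rw [integral_sub hint (integrable_const μ), hmean]; simp
  have hE : ∫ ω, g (X ω) ∂P ≤ 1 / (k ^ 2 + 1) := by
    have h3 : Integrable (fun ω => (X ω - μ) ^ 2 + (2 * (σ / k)) * (X ω - μ)) P :=
      hX2.add (hXc.const_mul _)
    rw [hgeq, integral_mul_const, integral_add h3 (integrable_const _),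
      integral_add hX2 (hXc.const_mul _), integral_const_mul, hmean0]
    have h2 : (σ ^ 2 + (σ / k) ^ 2) * (c ^ 2)⁻¹ = 1 / (k ^ 2 + 1) := by
      rw [hcdef]
      have : k * σ + σ / k = σ * (k ^ 2 + 1) / k := by field_simp
      rw [this]; field_simp
    rw [← h2]
    simp only [integral_const, probReal_univ, one_smul, mul_zero, add_zero]
    gcongr
  calc P {ω | X ω - μ ≥ Real.sqrt (U ω) * c - σ / k}
      ≤ P ((fun ω => (X ω, U ω)) ⁻¹' {p : ℝ × ℝ | p.2 ≤ g p.1}) := measure_mono hsub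
    _ = ∫⁻ x, (P.map U) {u | u ≤ g x} ∂(P.map X) := by
        rw [← Measure.map_apply (hXmeas.prodMk hUmeas) hS,
          (indepFun_iff_map_prod_eq_prod_map_map hXmeas.aemeasurable hUmeas.aemeasurable).1 hindep]
        have := Measure.isProbabilityMeasure_map (μ := P) hUmeas.aemeasurable
        rw [Measure.prod_apply hS]
        rfl
    _ ≤ ∫⁻ x, ENNReal.ofReal (g x) ∂(P.map X) := by
        apply lintegral_mono
        intro x
        have hgx : 0 ≤ g x := sq_nonneg _
        simp only
        rw [Measure.map_apply hUmeas (show MeasurableSet {u : ℝ | u ≤ g x} from measurableSet_Iic)]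
        by_cases h1 : g x ≤ 1
        · exact (hU (g x) ⟨hgx, h1⟩).le
        · refine prob_le_one.trans ?_
          rw [ENNReal.one_le_ofReal]
          exact (not_le.1 h1).le
    _ = ∫⁻ ω, ENNReal.ofReal (g (X ω)) ∂P := lintegral_map hg.ennreal_ofReal hXmeas
    _ = ENNReal.ofReal (∫ ω, g (X ω) ∂P) :=
        (ofReal_integral_eq_lintegral_ofReal hgint
          (Filter.Eventually.of_forall fun ω => sq_nonneg _)).symm
    _ ≤ ENNReal.ofReal (1 / (k ^ 2 + 1)) := ENNReal.ofReal_le_ofReal hE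
end
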